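/- (Newton relations, antisymmetric form.) Let R̂ be a Hecke R-matrix for the parameter q with m_q ≠ 0 for all m ≥ 1, let F̂ be a closed R-matrix compatible with R̂, and let M be a matrix of generators of M(R̂,F̂) over a unital associative k-algebra A. Then for every k ≥ 1: (−1)^{k−1} k_q σ_k(M) = Σ_{i=0}^{k−1} (−q)^i s_{k−i}(M) σ_i(M) in A. -/

import Mathlib

/-! Common definitions for quantum matrix algebras `M(R̂,F̂)` in the sense of
Isaev–Ogievetsky–Pyatov, "On quantum matrix algebras satisfying the
Cayley-Hamilton-Newton identities".

We model operators on `V^{⊗m}` (where `dim V = N`) as matrices indexed by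
multi-indices `Fin m → Fin N`; entries are taken in a (possibly
noncommutative) unital associative algebra `A` over a field `K`.
Sites (tensor factors) are numbered starting from `0`, so the paper's
`X_i` is `site m (i-1) X`, and the paper's `M_{\overline{k}}` is
`Mbar m F F⁻¹ M (k-1)`. -/

namespace CHN

noncomputable section

/-- Operators on `V^{⊗m}` (`dim V = N`) with entries in a ring `A`. -/
abbrev Op (N : ℕ) (A : Type*) [Ring A] (m : ℕ) :=
  Matrix (Fin m → Fin N) (Fin m → Fin N) A

/-- Operators on `V ⊗ V`. -/
abbrev M2 (N : ℕ) (A : Type*) [Ring A] :=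
  Matrix (Fin N × Fin N) (Fin N × Fin N) A

/-- `site m i X` places the two-site operator `X` at the (0-based) tensor
factors `i, i+1` of `V^{⊗m}`, acting as the identity elsewhere.  In the
paper's 1-based notation, `X_i = site m (i-1) X`.  (Out of range it is the
identity.) -/
def site {A : Type*} [Ring A] {N : ℕ} (m i : ℕ) (X : M2 N A) : Op N A m :=
  fun a b =>
    if h : i + 1 < m then
      X (a ⟨i, Nat.lt_of_succ_lt h⟩, a ⟨i + 1, h⟩)
          (b ⟨i, Nat.lt_of_succ_lt h⟩, b ⟨i + 1, h⟩) *
        (if ∀ j : Fin m, (j : ℕ) ≠ i → (j : ℕ) ≠ i + 1 → a j = b j then 1 else 0)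
    else if a = b then 1 else 0

/-- `site1 m i X` places the one-site operator `X` at the (0-based) factor `i`. -/
def site1 {A : Type*} [Ring A] {N : ℕ} (m i : ℕ) (X : Matrix (Fin N) (Fin N) A) :
    Op N A m :=
  fun a b =>
    if h : i < m then
      X (a ⟨i, h⟩) (b ⟨i, h⟩) *
        (if ∀ j : Fin m, (j : ℕ) ≠ i → a j = b j then 1 else 0)
    else if a = b then 1 else 0

/-- `chain m X i l = X_i X_{i+1} ⋯ X_{i+l-1}` (0-based sites, `l` factors); in
the paper's 1-based notation this is `X_{i+1 → i+l}`. -/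
def chain {A : Type*} [Ring A] {N : ℕ} (m : ℕ) (X : M2 N A) (i : ℕ) :
    ℕ → Op N A m
  | 0 => 1
  | l + 1 => chain m X i l * site m (i + l) X

/-- The Yang–Baxter equation `X₁X₂X₁ = X₂X₁X₂` on `V^{⊗3}`. -/
def YB {A : Type*} [Ring A] {N : ℕ} (X : M2 N A) : Prop :=
  site 3 0 X * site 3 1 X * site 3 0 X = site 3 1 X * site 3 0 X * site 3 1 X

/-- Compatibility of a pair of R-matrices: both Yang–Baxter equations together
with the conditions `R̂₁F̂₂F̂₁ = F̂₂F̂₁R̂₂` and `F̂₁F̂₂R̂₁ = R̂₂F̂₁F̂₂` on `V^{⊗3}`. -/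
def Compatible {A : Type*} [Ring A] {N : ℕ} (R F : M2 N A) : Prop :=
  YB R ∧ YB F ∧
    site 3 0 R * site 3 1 F * site 3 0 F = site 3 1 F * site 3 0 F * site 3 1 R ∧
    site 3 0 F * site 3 1 F * site 3 0 R = site 3 1 R * site 3 0 F * site 3 1 F

/-- `Ψ` witnesses closedness of `F̂`:  `Ψ^{af}_{cg} F̂^{gb}_{fd} = δ^a_d δ^b_c`. -/
def IsClosedPair {A : Type*} [Ring A] {N : ℕ} (F Ψ : M2 N A) : Prop :=
  ∀ a b c d : Fin N,
    (∑ f : Fin N, ∑ g : Fin N, Ψ (a, f) (c, g) * F (g, b) (f, d)) =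
      if a = d ∧ b = c then 1 else 0

/-- The matrix `D`, `D^a_b := Ψ^{ac}_{bc}`. -/
def Dmat {A : Type*} [Ring A] {N : ℕ} (Ψ : M2 N A) : Matrix (Fin N) (Fin N) A :=
  fun a b => ∑ c : Fin N, Ψ (a, c) (b, c)

/-- Quantum trace (with weight `D`) over the last tensor factor. -/
def qtr1 {K : Type*} [Field K] {A : Type*} [Ring A] [Algebra K A] {N m : ℕ}
    (D : Matrix (Fin N) (Fin N) K) (X : Op N A (m + 1)) : Op N A m :=
  fun a b => ∑ c : Fin N, ∑ e : Fin N,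
    algebraMap K A (D c e) * X (Fin.snoc a e) (Fin.snoc b c)

/-- Quantum trace over the last `j` tensor factors. -/
def qtrs {K : Type*} [Field K] {A : Type*} [Ring A] [Algebra K A] {N : ℕ}
    (D : Matrix (Fin N) (Fin N) K) (m : ℕ) :
    (j : ℕ) → Op N A (m + j) → Op N A m
  | 0, X => X
  | j + 1, X => qtrs D m j (qtr1 D X)

/-- Full quantum trace `Tr_F(1,…,m)`, with values in `A`. -/
def qtrAll {K : Type*} [Field K] {A : Type*} [Ring A] [Algebra K A] {N m : ℕ}
    (D : Matrix (Fin N) (Fin N) K) (X : Op N A m) : A :=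
  ∑ a : Fin m → Fin N, ∑ b : Fin m → Fin N,
    algebraMap K A (∏ i, D (a i) (b i)) * X b a

/-- Quantum trace of a one-site operator:  `Tr_F X = Tr (D X)`. -/
def trF {K : Type*} [Field K] {A : Type*} [Ring A] [Algebra K A] {N : ℕ}
    (D : Matrix (Fin N) (Fin N) K) (X : Matrix (Fin N) (Fin N) A) : A :=
  ∑ a : Fin N, ∑ b : Fin N, algebraMap K A (D a b) * X b a

/-- Ordinary partial trace over the last tensor factor. -/
def ptr1 {A : Type*} [Ring A] {N m : ℕ} (X : Op N A (m + 1)) : Op N A m :=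
  fun a b => ∑ c : Fin N, X (Fin.snoc a c) (Fin.snoc b c)

/-- Ordinary partial trace over the last `j` tensor factors. -/
def ptrs {A : Type*} [Ring A] {N : ℕ} (m : ℕ) :
    (j : ℕ) → Op N A (m + j) → Op N A m
  | 0, X => X
  | j + 1, X => ptrs m j (ptr1 X)

/-- `Mbar m F Finv M k` is the paper's `M_{\overline{k+1}}` (0-based index `k`):
`M_{\overline{1}} := M₁` and `M_{\overline{k+1}} := F̂_k M_{\overline{k}} F̂_k⁻¹`. -/
def Mbar {A : Type*} [Ring A] {N : ℕ} (m : ℕ) (F Finv : M2 N A)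
    (M : Matrix (Fin N) (Fin N) A) : ℕ → Op N A m
  | 0 => site1 m 0 M
  | k + 1 => site m k F * Mbar m F Finv M k * site m k Finv

/-- `MbarSeg m F Finv M i l = M_{\overline{i+1}} M_{\overline{i+2}} ⋯ M_{\overline{i+l}}`,
the ordered product of `l` consecutive copies starting at 0-based index `i`.
In particular `MbarSeg m F Finv M 0 k = M_{\overline{1}} ⋯ M_{\overline{k}}`. -/
def MbarSeg {A : Type*} [Ring A] {N : ℕ} (m : ℕ) (F Finv : M2 N A)
    (M : Matrix (Fin N) (Fin N) A) (i : ℕ) : ℕ → Op N A m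
  | 0 => 1
  | l + 1 => MbarSeg m F Finv M i l * Mbar m F Finv M (i + l)

/-- The double twist `R̂^{FF} = F̂ (F̂ R̂ F̂⁻¹) F̂⁻¹`. -/
def RFF {K : Type*} [Field K] {N : ℕ} (R F : M2 N K) : M2 N K :=
  F * (F * R * F⁻¹) * F⁻¹

/-- `M` is a matrix of generators of the algebra `M(R̂,F̂)`:
`R̂₁ M_{\overline{1}} M_{\overline{2}} = M_{\overline{1}} M_{\overline{2}} (R̂^{FF})₁`
on `V ⊗ V`. -/
def IsGenerators {K : Type*} [Field K] {A : Type*} [Ring A] [Algebra K A] {N : ℕ}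
    (R F : M2 N K) (M : Matrix (Fin N) (Fin N) A) : Prop :=
  site 2 0 (R.map (algebraMap K A)) *
      MbarSeg 2 (F.map (algebraMap K A)) ((F⁻¹).map (algebraMap K A)) M 0 2 =
    MbarSeg 2 (F.map (algebraMap K A)) ((F⁻¹).map (algebraMap K A)) M 0 2 *
      site 2 0 ((RFF R F).map (algebraMap K A))

/-- Evaluation of a noncommutative polynomial `Y` in `v` variables, substituting
for the variable `x_j` the operator `R̂` placed at the (0-based) sites
`p+j, p+j+1` of `V^{⊗m}`.  For `p = 0` this is the paper's
`Y^{(v+1)} = Y^{(v+1)}(R̂₁,…,R̂_v)`, and a general `p` gives `Y^{(p+1,v+1)}`. -/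
def evalY {K : Type*} [Field K] {A : Type*} [Ring A] [Algebra K A] {N m v : ℕ}
    (R : M2 N A) (p : ℕ) (Y : FreeAlgebra K (Fin v)) : Op N A m :=
  FreeAlgebra.lift K (fun j : Fin v => site m (p + (j : ℕ)) R) Y

/-- `Ustack m R k l = R̂_{l → l+k-1} ⋯ R̂_{2 → k+1} R̂_{1 → k}` (1-based labels):
the product of `l` descending chains of length `k`. -/
def Ustack {A : Type*} [Ring A] {N : ℕ} (m : ℕ) (R : M2 N A) (k : ℕ) :
    ℕ → Op N A m
  | 0 => 1
  | l + 1 => chain m R l k * Ustack m R k l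

/-- The `q`-number `n_q = (qⁿ − q⁻ⁿ)/(q − q⁻¹)`. -/
def qInt {K : Type*} [Field K] (q : K) (n : ℕ) : K :=
  (q ^ n - q⁻¹ ^ n) / (q - q⁻¹)

/-- `R̂` is a Hecke R-matrix for the parameter `q`:  it is invertible, satisfies
the Yang–Baxter equation and the Hecke condition `R̂² = 1 + (q − q⁻¹)R̂`. -/
def IsHecke {K : Type*} [Field K] {N : ℕ} (q : K) (R : M2 N K) : Prop :=
  IsUnit R ∧ YB R ∧ R * R = 1 + (q - q⁻¹) • R

/-- The `q`-antisymmetrizer `A^{(k)}` built from `R̂`, placed at the (0-based)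
tensor factors `p, p+1, …, p+k-1` of `V^{⊗m}`. -/
def qasym {K : Type*} [Field K] {N : ℕ} (q : K) (R : M2 N K) (m p : ℕ) :
    ℕ → Op N K m
  | 0 => 1
  | 1 => 1
  | k + 2 =>
      (qInt q (k + 2))⁻¹ •
        (qasym q R m p (k + 1) *
          (q ^ (k + 1) • (1 : Op N K m) - qInt q (k + 1) • site m (p + k) R) *
          qasym q R m p (k + 1))

/-- The `q`-symmetrizer `S^{(k)}` built from `R̂`, placed at the (0-based)
tensor factors `p, p+1, …, p+k-1` of `V^{⊗m}`. -/
def qsym {K : Type*} [Field K] {N : ℕ} (q : K) (R : M2 N K) (m p : ℕ) :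
    ℕ → Op N K m
  | 0 => 1
  | 1 => 1
  | k + 2 =>
      (qInt q (k + 2))⁻¹ •
        (qsym q R m p (k + 1) *
          (q⁻¹ ^ (k + 1) • (1 : Op N K m) + qInt q (k + 1) • site m (p + k) R) *
          qsym q R m p (k + 1))

/-- The elementary symmetric function
`σ_k(M) = Tr_F(1,…,k)(A^{(k)} M_{\overline{1}}⋯M_{\overline{k}})` (with `σ_0 = 1`). -/
def sigmaF {K : Type*} [Field K] {A : Type*} [Ring A] [Algebra K A] {N : ℕ}
    (q : K) (R F Ψ : M2 N K) (M : Matrix (Fin N) (Fin N) A) (k : ℕ) : A :=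
  qtrAll (Dmat Ψ)
    ((qasym q R k 0 k).map (algebraMap K A) *
      MbarSeg k (F.map (algebraMap K A)) ((F⁻¹).map (algebraMap K A)) M 0 k)

/-- The complete symmetric function
`τ_k(M) = Tr_F(1,…,k)(S^{(k)} M_{\overline{1}}⋯M_{\overline{k}})` (with `τ_0 = 1`). -/
def tauF {K : Type*} [Field K] {A : Type*} [Ring A] [Algebra K A] {N : ℕ}
    (q : K) (R F Ψ : M2 N K) (M : Matrix (Fin N) (Fin N) A) (k : ℕ) : A :=
  qtrAll (Dmat Ψ)
    ((qsym q R k 0 k).map (algebraMap K A) *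
      MbarSeg k (F.map (algebraMap K A)) ((F⁻¹).map (algebraMap K A)) M 0 k)

/-- The power sums `s_k(M) = Tr_F(1,…,k)(R̂_{1→k−1} M_{\overline{1}}⋯M_{\overline{k}})`,
with `s_0 = 1`. -/
def sF {K : Type*} [Field K] {A : Type*} [Ring A] [Algebra K A] {N : ℕ}
    (R F Ψ : M2 N K) (M : Matrix (Fin N) (Fin N) A) : ℕ → A
  | 0 => 1
  | j + 1 =>
      qtrAll (Dmat Ψ)
        (chain (j + 1) (R.map (algebraMap K A)) 0 j *
          MbarSeg (j + 1) (F.map (algebraMap K A)) ((F⁻¹).map (algebraMap K A)) M 0 (j + 1))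

/-- The `(j+1)`-st quantum power of `M`,
`M^{\overline{j+1}} = Tr_F(2,…,j+1)(R̂_{1→j} M_{\overline{1}}⋯M_{\overline{j+1}})`,
as a one-site operator (so `MpowF R F Ψ M 0 = M₁ = M`). -/
def MpowF {K : Type*} [Field K] {A : Type*} [Ring A] [Algebra K A] {N : ℕ}
    (R F Ψ : M2 N K) (M : Matrix (Fin N) (Fin N) A) (j : ℕ) : Op N A 1 :=
  qtrs (Dmat Ψ) 1 j
    (chain (1 + j) (R.map (algebraMap K A)) 0 j *
      MbarSeg (1 + j) (F.map (algebraMap K A)) ((F⁻¹).map (algebraMap K A)) M 0 (j + 1))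

/-- The `(j+1)`-st wedge power of `M`,
`M^{∧(j+1)} = Tr_F(2,…,j+1)(A^{(j+1)} M_{\overline{1}}⋯M_{\overline{j+1}})`. -/
def MwedgeF {K : Type*} [Field K] {A : Type*} [Ring A] [Algebra K A] {N : ℕ}
    (q : K) (R F Ψ : M2 N K) (M : Matrix (Fin N) (Fin N) A) (j : ℕ) : Op N A 1 :=
  qtrs (Dmat Ψ) 1 j
    ((qasym q R (1 + j) 0 (j + 1)).map (algebraMap K A) *
      MbarSeg (1 + j) (F.map (algebraMap K A)) ((F⁻¹).map (algebraMap K A)) M 0 (j + 1))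

/-- The `(j+1)`-st symmetric power of `M`,
`M^{S(j+1)} = Tr_F(2,…,j+1)(S^{(j+1)} M_{\overline{1}}⋯M_{\overline{j+1}})`. -/
def MsymF {K : Type*} [Field K] {A : Type*} [Ring A] [Algebra K A] {N : ℕ}
    (q : K) (R F Ψ : M2 N K) (M : Matrix (Fin N) (Fin N) A) (j : ℕ) : Op N A 1 :=
  qtrs (Dmat Ψ) 1 j
    ((qsym q R (1 + j) 0 (j + 1)).map (algebraMap K A) *
      MbarSeg (1 + j) (F.map (algebraMap K A)) ((F⁻¹).map (algebraMap K A)) M 0 (j + 1))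

/-- `M^{\overline{0}} := q^{-n} n_q Tr_{(2,…,n)}(A^{(n)}) D^{-1}`, with `n = n0 + 1`
(an ordinary, non-quantum, trace over the factors `2,…,n`). -/
def MzeroF {K : Type*} [Field K] {N : ℕ} (q : K) (R Ψ : M2 N K) (n0 : ℕ) :
    Op N K 1 :=
  (q⁻¹ ^ (n0 + 1) * qInt q (n0 + 1)) •
    (ptrs 1 n0 (qasym q R (1 + n0) 0 (n0 + 1)) * site1 1 0 ((Dmat Ψ)⁻¹))

/-- The generators of the characteristic subalgebra: all elements
`α(Y^{(k)}) = Tr_F(1,…,k)(Y^{(k)} M_{\overline{1}}⋯M_{\overline{k}})`, `k ≥ 1`. -/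
def charSet {K : Type*} [Field K] {A : Type*} [Ring A] [Algebra K A] {N : ℕ}
    (R F Ψ : M2 N K) (M : Matrix (Fin N) (Fin N) A) : Set A :=
  { x : A | ∃ (v : ℕ) (Y : FreeAlgebra K (Fin v)),
      x = qtrAll (Dmat Ψ)
        (evalY (R.map (algebraMap K A)) 0 Y *
          MbarSeg (v + 1) (F.map (algebraMap K A)) ((F⁻¹).map (algebraMap K A)) M 0 (v + 1)) }

end

section HeckeFamily

variable {K : Type*} [Field K] {B : Type*} [Ring B] [Algebra K B]

/-- The generators `g 0, …, g (m - 2)` satisfy the relations of the Hecke algebra of type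
`A_{m-1}` with parameter `q`. -/
structure IsHeckeFamily (q : K) (g : ℕ → B) (m : ℕ) : Prop where
  braid : ∀ i, i + 2 < m → g i * g (i + 1) * g i = g (i + 1) * g i * g (i + 1)
  quad : ∀ i, i + 1 < m → g i * g i = 1 + (q - q⁻¹) • g i
  comm : ∀ i j, i + 1 < j → j + 1 < m → Commute (g i) (g j)

/-- The antisymmetrizer on the strands `p, …, p + k - 1` built from the generators `g`. -/
def asym (q : K) (g : ℕ → B) (p : ℕ) : ℕ → B
  | 0 => 1
  | 1 => 1
  | k + 2 =>
      (qInt q (k + 2))⁻¹ •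
        (asym q g p (k + 1) * (q ^ (k + 1) • (1 : B) - qInt q (k + 1) • g (p + k)) *
          asym q g p (k + 1))

theorem qInt_zero (q : K) : qInt q 0 = 0 := by simp [qInt]

theorem sub_inv_ne_zero_of_sq_ne_one {q : K} (hq0 : q ≠ 0) (hq1 : q ^ 2 ≠ 1) : q - q⁻¹ ≠ 0 := by
  intro h
  apply hq1
  have : q = q⁻¹ := sub_eq_zero.mp h
  rw [pow_two]
  nth_rewrite 2 [this]
  exact mul_inv_cancel₀ hq0

theorem qInt_one {q : K} (hq0 : q ≠ 0) (hq1 : q ^ 2 ≠ 1) : qInt q 1 = 1 := by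
  simp [qInt, div_self (sub_inv_ne_zero_of_sq_ne_one hq0 hq1)]

theorem qInt_succ {q : K} (hq0 : q ≠ 0) (hq1 : q ^ 2 ≠ 1) (k : ℕ) :
    qInt q (k + 1) = q ^ k + qInt q k * q⁻¹ := by
  have := sub_inv_ne_zero_of_sq_ne_one hq0 hq1
  unfold qInt
  field_simp
  linear_combination -q⁻¹ ^ k * inv_mul_cancel₀ hq0

theorem asym_op (q : K) (g : ℕ → B) (p : ℕ) :
    ∀ k, MulOpposite.op (asym q g p k) = asym q (fun i => MulOpposite.op (g i)) p k
  | 0 => rfl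
  | 1 => rfl
  | k + 2 => by
    simp only [asym, MulOpposite.op_smul, MulOpposite.op_mul, MulOpposite.op_sub,
      MulOpposite.op_one, asym_op q g p (k + 1), mul_assoc]

theorem IsHeckeFamily.op {q : K} {g : ℕ → B} {m : ℕ} (hg : IsHeckeFamily q g m) :
    IsHeckeFamily q (fun i => MulOpposite.op (g i)) m where
  braid i hi := by
    simp only [← MulOpposite.op_mul, ← mul_assoc, hg.braid i hi]
  quad i hi := by
    simp only [← MulOpposite.op_mul, hg.quad i hi, MulOpposite.op_add, MulOpposite.op_one,
      MulOpposite.op_smul]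
  comm i j hi hj := by
    have := hg.comm i j hi hj
    exact this.op

theorem Commute.asym_right {q : K} {g : ℕ → B} {p : ℕ} {x : B} :
    ∀ k, (∀ i, p ≤ i → i + 1 < p + k → Commute x (g i)) → Commute x (asym q g p k)
  | 0, _ => Commute.one_right x
  | 1, _ => Commute.one_right x
  | k + 2, h => by
    have ih : Commute x (asym q g p (k + 1)) :=
      Commute.asym_right (k + 1) fun i hi hk => h i hi (by omega)
    have h1 : Commute x (g (p + k)) := h _ (by omega) (by omega)
    rw [asym]
    exact ((ih.mul_right (((Commute.one_right x).smul_right _).sub_right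
      (h1.smul_right _))).mul_right ih).smul_right _

theorem smul_asym_succ {q : K} (hqn : ∀ n : ℕ, 1 ≤ n → qInt q n ≠ 0) (hq0 : q ≠ 0)
    (hq1 : q ^ 2 ≠ 1) (g : ℕ → B) (p k : ℕ) :
    qInt q (k + 1) • asym q g p (k + 1) =
      asym q g p k * (q ^ k • (1 : B) - qInt q k • g (p + k - 1)) * asym q g p k := by
  cases k with
  | zero => simp [asym, qInt_zero, qInt_one hq0 hq1]
  | succ k =>
    rw [asym, smul_inv_smul₀ (hqn _ (by omega))]
    rfl

/-- If every generator acts on `x` by `-q⁻¹`, then the antisymmetrizer fixes `x`. -/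
theorem asym_mul_of_eigen {q : K} (hqn : ∀ n : ℕ, 1 ≤ n → qInt q n ≠ 0) (hq0 : q ≠ 0)
    (hq1 : q ^ 2 ≠ 1) {g : ℕ → B} {p : ℕ} {x : B} :
    ∀ k, (∀ i, p ≤ i → i + 1 < p + k → g i * x = -q⁻¹ • x) → asym q g p k * x = x
  | 0, _ => one_mul x
  | 1, _ => one_mul x
  | k + 2, h => by
    have ih : asym q g p (k + 1) * x = x :=
      asym_mul_of_eigen hqn hq0 hq1 (k + 1) fun i hi hk => h i hi (by omega)
    have h1 : g (p + k) * x = -q⁻¹ • x := h _ (by omega) (by omega)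
    have h2 : (q ^ (k + 1) • (1 : B) - qInt q (k + 1) • g (p + k)) * x =
        qInt q (k + 2) • x := by
      rw [sub_mul, smul_mul_assoc, smul_mul_assoc, one_mul, h1, qInt_succ hq0 hq1 (k + 1)]
      module
    rw [asym, smul_mul_assoc, mul_assoc, mul_assoc, ih, h2, mul_smul_comm, ih,
      inv_smul_smul₀ (hqn _ (by omega))]

theorem mul_asym_of_eigen {q : K} (hqn : ∀ n : ℕ, 1 ≤ n → qInt q n ≠ 0) (hq0 : q ≠ 0)
    (hq1 : q ^ 2 ≠ 1) {g : ℕ → B} {p : ℕ} {x : B} (k : ℕ)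
    (h : ∀ i, p ≤ i → i + 1 < p + k → x * g i = -q⁻¹ • x) : x * asym q g p k = x := by
  apply MulOpposite.op_injective
  rw [MulOpposite.op_mul, asym_op]
  refine asym_mul_of_eigen hqn hq0 hq1 k fun i hi hk => ?_
  rw [← MulOpposite.op_mul, h i hi hk, MulOpposite.op_smul]

/-- Absorption of a further generator `s` by the next antisymmetrizer. -/
theorem eigen_step {q : K} (hq0 : q ≠ 0) {a b r s : B} {c d : K} {n : ℕ}
    (hA : d • a = b * (q ^ n • (1 : B) - c • r) * b) (hsb : Commute s b)
    (hba : b * a = a) (hra : r * a = -q⁻¹ • a) (haa : a * a = a)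
    (hs : s * s = 1 + (q - q⁻¹) • s) (hrs : r * s * r = s * r * s) :
    s * (a * (q ^ (n + 1) • (1 : B) - d • s) * a) =
      -q⁻¹ • (a * (q ^ (n + 1) • (1 : B) - d • s) * a) := by
  have h1 : d • (a * s * a) = q ^ n • (s * a) - c • (b * r * s * a) := by
    rw [← smul_mul_assoc, ← smul_mul_assoc, hA]
    have e1 : b * (q ^ n • (1 : B) - c • r) * b * s * a =
        b * (q ^ n • (1 : B) - c • r) * (s * (b * a)) := by
      simp only [mul_assoc]
      rw [← mul_assoc b s a, ← hsb.eq, mul_assoc]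
    rw [e1, hba]
    have e2 : b * (s * a) = s * a := by rw [← mul_assoc, ← hsb.eq, mul_assoc, hba]
    simp only [mul_sub, sub_mul, mul_smul_comm, smul_mul_assoc, mul_one, mul_assoc, e2]
  have h2 : a * (q ^ (n + 1) • (1 : B) - d • s) * a =
      q ^ (n + 1) • a - q ^ n • (s * a) + c • (b * r * s * a) := by
    rw [mul_sub, sub_mul, mul_smul_comm, mul_one, smul_mul_assoc, haa, mul_smul_comm,
      smul_mul_assoc, h1]
    abel
  have h3 : s * (b * r * s * a) = -q⁻¹ • (b * r * s * a) := by
    calc s * (b * r * s * a) = b * (s * r * s) * a := by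
          simp only [← mul_assoc, hsb.eq]
      _ = b * r * s * (r * a) := by rw [← hrs]; simp only [mul_assoc]
      _ = _ := by rw [hra, mul_smul_comm]
  rw [h2, mul_add, mul_sub, mul_smul_comm, mul_smul_comm, mul_smul_comm, h3, ← mul_assoc, hs,
    add_mul, smul_mul_assoc, one_mul]
  have : q ^ (n + 1) = q ^ n * q := pow_succ q n
  have h4 : q⁻¹ * q = 1 := inv_mul_cancel₀ hq0
  rw [this]
  match_scalars <;> first | ring1 | linear_combination q ^ n * h4

theorem asym_eigen_left {q : K} (hqn : ∀ n : ℕ, 1 ≤ n → qInt q n ≠ 0) (hq0 : q ≠ 0)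
    (hq1 : q ^ 2 ≠ 1) {g : ℕ → B} {m : ℕ} (hg : IsHeckeFamily q g m) {p : ℕ} :
    ∀ k, p + k ≤ m → ∀ i, p ≤ i → i + 1 < p + k → g i * asym q g p k = -q⁻¹ • asym q g p k
  | 0, _ => by intro i; omega
  | 1, _ => by intro i; omega
  | k + 2, hk => by
    intro i hi hik
    have ih := asym_eigen_left hqn hq0 hq1 hg (p := p) (k + 1) (by omega)
    have haa := asym_mul_of_eigen hqn hq0 hq1 (k + 1) ih
    rw [asym, mul_smul_comm, smul_comm (-q⁻¹)]
    congr 1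
    rcases Nat.lt_or_ge i (p + k) with h | h
    · rw [← mul_assoc, ← mul_assoc, ih i hi (by omega), smul_mul_assoc, smul_mul_assoc]
    · obtain rfl : i = p + k := by omega
      cases k with
      | zero =>
        simp only [asym, one_mul, mul_one, qInt_one hq0 hq1, zero_add, pow_one, one_smul]
        rw [mul_sub, hg.quad _ (by omega), mul_smul_comm, mul_one]
        have h4 : q⁻¹ * q = 1 := inv_mul_cancel₀ hq0
        match_scalars <;> first | ring1 | linear_combination -h4 | linear_combination h4
      | succ k =>
        have ih' := asym_eigen_left hqn hq0 hq1 hg (p := p) (k + 1) (by omega)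
        refine eigen_step hq0 (b := asym q g p (k + 1)) (r := g (p + k)) (c := qInt q (k + 1))
          ?_ ?_ ?_ ?_ haa (hg.quad _ (by omega)) ?_
        · exact smul_asym_succ hqn hq0 hq1 g p (k + 1)
        · refine Commute.asym_right _ fun i hi hk => (hg.comm i _ ?_ ?_).symm <;> omega
        · exact asym_mul_of_eigen hqn hq0 hq1 _ fun i hi hk => ih i hi (by omega)
        · exact ih _ (by omega) (by omega)
        · exact hg.braid _ (by omega)

theorem asym_eigen_right {q : K} (hqn : ∀ n : ℕ, 1 ≤ n → qInt q n ≠ 0) (hq0 : q ≠ 0)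
    (hq1 : q ^ 2 ≠ 1) {g : ℕ → B} {m : ℕ} (hg : IsHeckeFamily q g m) {p : ℕ}
    (k : ℕ) (hk : p + k ≤ m) (i : ℕ) (hi : p ≤ i) (hik : i + 1 < p + k) :
    asym q g p k * g i = -q⁻¹ • asym q g p k := by
  apply MulOpposite.op_injective
  rw [MulOpposite.op_mul, MulOpposite.op_smul, asym_op]
  exact asym_eigen_left hqn hq0 hq1 hg.op k hk i hi hik

theorem asym_mul_self {q : K} (hqn : ∀ n : ℕ, 1 ≤ n → qInt q n ≠ 0) (hq0 : q ≠ 0)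
    (hq1 : q ^ 2 ≠ 1) {g : ℕ → B} {m : ℕ} (hg : IsHeckeFamily q g m) {p : ℕ}
    (k : ℕ) (hk : p + k ≤ m) : asym q g p k * asym q g p k = asym q g p k :=
  asym_mul_of_eigen hqn hq0 hq1 k (asym_eigen_left hqn hq0 hq1 hg k hk)

/-- The recursion for the antisymmetrizer that adds a strand on the left. -/
theorem smul_asym_succ_left {q : K} (hqn : ∀ n : ℕ, 1 ≤ n → qInt q n ≠ 0) (hq0 : q ≠ 0)
    (hq1 : q ^ 2 ≠ 1) {g : ℕ → B} {m : ℕ} (hg : IsHeckeFamily q g m) (k : ℕ) :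
    ∀ p, p + k + 1 ≤ m →
    qInt q (k + 1) • asym q g p (k + 1) =
      asym q g (p + 1) k * (q ^ k • (1 : B) - qInt q k • g p) * asym q g (p + 1) k := by
  induction k with
  | zero => intro p _; simp [asym, qInt_zero, qInt_one hq0 hq1]
  | succ k ih =>
    intro p hp
    set a := asym q g (p + 1) (k + 1) with ha
    set L := a * (q ^ (k + 1) • (1 : B) - qInt q (k + 1) • g p) * a with hL
    have hal := asym_eigen_left hqn hq0 hq1 hg (p := p + 1) (k + 1) (by omega)
    have hE : ∀ i, p ≤ i → i + 1 < p + (k + 2) → g i * L = -q⁻¹ • L := by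
      intro i hi hik
      rcases Nat.lt_or_ge p i with h | h
      · rw [hL, ← mul_assoc, ← mul_assoc, hal i (by omega) (by omega), smul_mul_assoc,
          smul_mul_assoc]
      · obtain rfl : i = p := by omega
        cases k with
        | zero =>
          simp only [hL, ha, asym, one_mul, mul_one, qInt_one hq0 hq1, zero_add, pow_one,
            one_smul]
          rw [mul_sub, hg.quad _ (by omega), mul_smul_comm, mul_one]
          have h4 : q⁻¹ * q = 1 := inv_mul_cancel₀ hq0
          match_scalars <;> first | ring1 | linear_combination -h4 | linear_combination h4
        | succ k =>
          refine eigen_step hq0 (b := asym q g (i + 1 + 1) (k + 1)) (r := g (i + 1))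
            (c := qInt q (k + 1)) ?_ ?_ ?_ ?_ ?_ (hg.quad _ (by omega)) ?_
          · exact ih (i + 1) (by omega)
          · refine Commute.asym_right _ fun j hj hk => hg.comm _ _ ?_ ?_ <;> omega
          · exact asym_mul_of_eigen hqn hq0 hq1 _ fun j hj hk => hal j (by omega) (by omega)
          · exact hal _ (by omega) (by omega)
          · exact asym_mul_self hqn hq0 hq1 hg _ (by omega)
          · exact (hg.braid _ (by omega)).symm
    have h1 : asym q g p (k + 2) * L = L := asym_mul_of_eigen hqn hq0 hq1 _ hE
    have hr := asym_eigen_right hqn hq0 hq1 hg (p := p) (k + 2) (by omega)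
    have h2 : asym q g p (k + 2) * a = asym q g p (k + 2) :=
      mul_asym_of_eigen hqn hq0 hq1 _ fun i hi hik => hr i (by omega) (by omega)
    rw [← h1, hL, ← mul_assoc, ← mul_assoc, h2, mul_sub, mul_smul_comm, mul_one, mul_smul_comm,
      hr p le_rfl (by omega), sub_mul, smul_mul_assoc, smul_mul_assoc, smul_mul_assoc, h2,
      qInt_succ hq0 hq1 (k + 1)]
    module

end HeckeFamily

section SumOrder

theorem sum_rot2 {ι M : Type*} [Fintype ι] [AddCommMonoid M] (φ : ι → ι → M) :
    ∑ a, ∑ b, φ a b =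
      ∑ b, ∑ a, φ a b := by
  exact Finset.sum_comm

theorem sum_rot3 {ι M : Type*} [Fintype ι] [AddCommMonoid M] (φ : ι → ι → ι → M) :
    ∑ a, ∑ b, ∑ c, φ a b c =
      ∑ c, ∑ a, ∑ b, φ a b c := by
  rw [Finset.sum_congr rfl fun a _ => sum_rot2 (φ a), Finset.sum_comm]

theorem sum_rot4 {ι M : Type*} [Fintype ι] [AddCommMonoid M] (φ : ι → ι → ι → ι → M) :
    ∑ a, ∑ b, ∑ c, ∑ d, φ a b c d =
      ∑ d, ∑ a, ∑ b, ∑ c, φ a b c d := by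
  rw [Finset.sum_congr rfl fun a _ => sum_rot3 (φ a), Finset.sum_comm]

theorem sum_rot5 {ι M : Type*} [Fintype ι] [AddCommMonoid M] (φ : ι → ι → ι → ι → ι → M) :
    ∑ a, ∑ b, ∑ c, ∑ d, ∑ e, φ a b c d e =
      ∑ e, ∑ a, ∑ b, ∑ c, ∑ d, φ a b c d e := by
  rw [Finset.sum_congr rfl fun a _ => sum_rot4 (φ a), Finset.sum_comm]

theorem sum_rot6 {ι M : Type*} [Fintype ι] [AddCommMonoid M] (φ : ι → ι → ι → ι → ι → ι → M) :
    ∑ a, ∑ b, ∑ c, ∑ d, ∑ e, ∑ f, φ a b c d e f =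
      ∑ f, ∑ a, ∑ b, ∑ c, ∑ d, ∑ e, φ a b c d e f := by
  rw [Finset.sum_congr rfl fun a _ => sum_rot5 (φ a), Finset.sum_comm]

end SumOrder

section SkewInverse

variable {K : Type*} [Field K] {N : ℕ}

theorem sum_skew_left {F Ψ : M2 N K} (hΨ : IsClosedPair F Ψ) (G H : Fin N → Fin N → K)
    (hG : ∀ a d, ∑ y, ∑ x, F (a, y) (d, x) * G y x = H a d) (t s : Fin N) :
    G t s = ∑ a, ∑ d, Ψ (s, d) (t, a) * H a d := by
  simp only [← hG, Finset.mul_sum, ← mul_assoc]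
  have e : ∑ a, ∑ d, ∑ y, ∑ x, Ψ (s, d) (t, a) * F (a, y) (d, x) * G y x =
      ∑ y, ∑ x, (∑ d, ∑ a, Ψ (s, d) (t, a) * F (a, y) (d, x)) * G y x := by
    simp only [Finset.sum_mul]
    rw [Finset.sum_comm, Finset.sum_congr rfl fun _ _ => Finset.sum_comm, Finset.sum_comm]
    refine Finset.sum_congr rfl fun y _ => ?_
    rw [Finset.sum_congr rfl fun _ _ => Finset.sum_comm, Finset.sum_comm]
  rw [e]
  simp only [hΨ s _ t _, ite_mul, one_mul, zero_mul]
  rw [Finset.sum_eq_single t, Finset.sum_eq_single s] <;> simp +contextual [eq_comm]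

theorem IsClosedPair.flip {F Ψ : M2 N K} (hΨ : IsClosedPair F Ψ) (y z p q : Fin N) :
    (∑ c, ∑ f, F (y, c) (z, f) * Ψ (f, p) (c, q)) = if z = p ∧ y = q then 1 else 0 := by
  let P : Matrix (Fin N × Fin N) (Fin N × Fin N) K := fun i j => Ψ (i.1, j.1) (i.2, j.2)
  let Q : Matrix (Fin N × Fin N) (Fin N × Fin N) K := fun i j => F (i.2, j.2) (i.1, j.1)
  have h : P * Q = 1 := by
    ext ⟨a, c⟩ ⟨d, b⟩
    rw [Matrix.mul_apply, Fintype.sum_prod_type, Matrix.one_apply]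
    simp only [P, Q]
    rw [hΨ a b c d]
    simp only [Prod.mk.injEq, eq_comm (a := b)]
  have h' := congrFun (congrFun (mul_eq_one_comm.mp h : Q * P = 1) (z, y)) (p, q)
  rw [Matrix.mul_apply, Fintype.sum_prod_type, Matrix.one_apply] at h'
  simp only [P, Q, Prod.mk.injEq] at h'
  rw [← h', Finset.sum_comm]

theorem sum_skew_right {F Ψ : M2 N K} (hΨ : IsClosedPair F Ψ) (G H : Fin N → Fin N → K)
    (hG : ∀ c f, ∑ y, ∑ z, F (y, c) (z, f) * G y z = H c f) (p q : Fin N) :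
    G q p = ∑ c, ∑ f, Ψ (f, p) (c, q) * H c f := by
  simp only [← hG, Finset.mul_sum, ← mul_assoc]
  have e : ∑ c, ∑ f, ∑ y, ∑ z, Ψ (f, p) (c, q) * F (y, c) (z, f) * G y z =
      ∑ y, ∑ z, (∑ c, ∑ f, F (y, c) (z, f) * Ψ (f, p) (c, q)) * G y z := by
    simp only [Finset.sum_mul, mul_comm (Ψ _ _)]
    rw [Finset.sum_congr rfl fun _ _ => Finset.sum_comm, Finset.sum_comm]
    refine Finset.sum_congr rfl fun y _ => ?_
    rw [Finset.sum_congr rfl fun _ _ => Finset.sum_comm, Finset.sum_comm]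
  rw [e]
  simp only [hΨ.flip, ite_mul, one_mul, zero_mul]
  rw [Finset.sum_eq_single q, Finset.sum_eq_single p] <;> simp +contextual [eq_comm]

/-- The compatibility relation `X₁F₂F₁ = F₂F₁X₂` written in components. -/
def TwistRel (X F : M2 N K) : Prop :=
  ∀ a b c d e f : Fin N,
    ∑ x, ∑ y, ∑ z, X (a, b) (x, y) * F (y, c) (z, f) * F (x, z) (d, e) =
      ∑ y, ∑ z, ∑ x, F (b, c) (y, z) * F (a, y) (d, x) * X (x, z) (e, f)

/-- Moving `X` through two copies of the skew inverse `Ψ` of `F`. -/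
theorem TwistRel.skew {X F Ψ : M2 N K} (hΨ : IsClosedPair F Ψ) (hX : TwistRel X F)
    (s u v q m n : Fin N) :
    ∑ e, ∑ f, ∑ p, X (s, u) (e, f) * Ψ (f, p) (v, q) * Ψ (e, m) (p, n) =
      ∑ a, ∑ b, ∑ t, Ψ (u, t) (v, b) * Ψ (s, m) (t, a) * X (a, b) (n, q) := by
  have h1 : ∀ a b d e p q : Fin N, ∑ x, X (a, b) (x, q) * F (x, p) (d, e) =
      ∑ c, ∑ f, Ψ (f, p) (c, q) *
        ∑ y, ∑ z, ∑ x, F (b, c) (y, z) * F (a, y) (d, x) * X (x, z) (e, f) := by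
    intro a b d e p q
    refine sum_skew_right hΨ (fun y z => ∑ x, X (a, b) (x, y) * F (x, z) (d, e)) _ ?_ p q
    intro c f
    rw [← hX]
    simp only [Finset.mul_sum]
    rw [Finset.sum_congr rfl fun _ _ => Finset.sum_comm, Finset.sum_comm]
    refine Finset.sum_congr rfl fun x _ => Finset.sum_congr rfl fun y _ =>
      Finset.sum_congr rfl fun z _ => ?_
    ring
  have h2 : ∀ b e p q t s : Fin N,
      ∑ c, ∑ f, ∑ z, Ψ (f, p) (c, q) * F (b, c) (t, z) * X (s, z) (e, f) =
      ∑ a, ∑ d, Ψ (s, d) (t, a) * ∑ x, X (a, b) (x, q) * F (x, p) (d, e) := by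
    intro b e p q t s
    refine sum_skew_left hΨ (fun t s => ∑ c, ∑ f, ∑ z,
      Ψ (f, p) (c, q) * F (b, c) (t, z) * X (s, z) (e, f)) _ ?_ t s
    intro a d
    rw [h1]
    simp only [Finset.mul_sum]
    refine (sum_rot3 _).trans (Finset.sum_congr rfl fun c _ => ?_)
    refine (sum_rot3 _).trans (Finset.sum_congr rfl fun f _ => ?_)
    refine Finset.sum_congr rfl fun y _ => ?_
    refine (sum_rot2 _).trans (Finset.sum_congr rfl fun z _ => ?_)
    refine Finset.sum_congr rfl fun x _ => ?_
    ring
  have h3 : ∀ b q t s m n : Fin N,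
      ∑ a, Ψ (s, m) (t, a) * X (a, b) (n, q) =
      ∑ p, ∑ e, Ψ (e, m) (p, n) *
        ∑ c, ∑ f, ∑ z, Ψ (f, p) (c, q) * F (b, c) (t, z) * X (s, z) (e, f) := by
    intro b q t s m n
    refine sum_skew_right hΨ (fun n m => ∑ a, Ψ (s, m) (t, a) * X (a, b) (n, q)) _ ?_ m n
    intro p e
    rw [h2]
    simp only [Finset.mul_sum]
    refine (sum_rot3 _).trans (Finset.sum_congr rfl fun a _ => ?_)
    refine (sum_rot2 _).trans (Finset.sum_congr rfl fun d _ => ?_)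
    refine Finset.sum_congr rfl fun x _ => ?_
    ring
  have h4 : ∀ q m n u v s : Fin N,
      ∑ e, ∑ f, ∑ p, X (s, u) (e, f) * Ψ (f, p) (v, q) * Ψ (e, m) (p, n) =
      ∑ b, ∑ t, Ψ (u, t) (v, b) * ∑ a, Ψ (s, m) (t, a) * X (a, b) (n, q) := by
    intro q m n u v s
    refine sum_skew_left hΨ (fun v u => ∑ e, ∑ f, ∑ p,
      X (s, u) (e, f) * Ψ (f, p) (v, q) * Ψ (e, m) (p, n)) _ ?_ v u
    intro b t
    rw [h3]
    simp only [Finset.mul_sum]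
    refine (sum_rot5 _).trans (Finset.sum_congr rfl fun p _ => ?_)
    refine (sum_rot3 _).trans (Finset.sum_congr rfl fun e _ => ?_)
    refine Finset.sum_congr rfl fun c _ => ?_
    refine (sum_rot2 _).trans (Finset.sum_congr rfl fun f _ => ?_)
    refine Finset.sum_congr rfl fun z _ => ?_
    ring
  rw [h4]
  simp only [Finset.mul_sum]
  refine (sum_rot3 _).trans (Finset.sum_congr rfl fun a _ => ?_)
  refine Finset.sum_congr rfl fun b _ => ?_
  refine Finset.sum_congr rfl fun t _ => ?_
  ring

/-- `Tr₅ (Ψ₀₅ Ψ₆₀ X₅₀)`, as an operator in the factors `0, 6`. -/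
def slideL (Ψ X : M2 N K) : M2 N K := fun i j =>
  ∑ a, ∑ b, ∑ t, ∑ m, Ψ (i.2, t) (j.2, b) * Ψ (i.1, m) (t, a) * X (a, b) (m, j.1)

/-- `Tr₅ (X₅₀ Ψ₆₀ Ψ₀₅)`, as an operator in the factors `0, 6`. -/
def slideR (Ψ X : M2 N K) : M2 N K := fun i j =>
  ∑ m, ∑ a, ∑ b, ∑ t, X (m, i.1) (a, b) * Ψ (i.2, b) (j.2, t) * Ψ (t, a) (j.1, m)

theorem slideL_slideL (Ψ X : M2 N K) : slideL Ψ (slideL Ψ X) = slideR Ψ (slideR Ψ X) := by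
  ext ⟨s, u⟩ ⟨q, v⟩
  simp only [slideL, slideR, Finset.mul_sum, Finset.sum_mul]
  refine (sum_rot6 _).trans (Finset.sum_congr rfl fun _ _ => ?_)
  refine (sum_rot6 _).trans (Finset.sum_congr rfl fun _ _ => ?_)
  refine (sum_rot3 _).trans (Finset.sum_congr rfl fun _ _ => ?_)
  refine (sum_rot2 _).trans (Finset.sum_congr rfl fun _ _ => ?_)
  refine (sum_rot3 _).trans (Finset.sum_congr rfl fun _ _ => ?_)
  refine (sum_rot3 _).trans (Finset.sum_congr rfl fun _ _ => ?_)
  refine (sum_rot2 _).trans (Finset.sum_congr rfl fun _ _ => ?_)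
  refine Finset.sum_congr rfl fun _ _ => ?_
  ring

theorem slideL_mul {X F Ψ : M2 N K} (hΨ : IsClosedPair F Ψ) (hX : TwistRel X F) (Y : M2 N K) :
    slideL Ψ (X * Y) = X * slideL Ψ Y := by
  ext ⟨s, u⟩ ⟨q, v⟩
  have h := hX.skew hΨ
  have e : slideL Ψ (X * Y) (s, u) (q, v) =
      ∑ m, ∑ n, ∑ q', (∑ a, ∑ b, ∑ t, Ψ (u, t) (v, b) * Ψ (s, m) (t, a) * X (a, b) (n, q')) *
        Y (n, q') (m, q) := by
    simp only [slideL, Matrix.mul_apply, Fintype.sum_prod_type, Finset.mul_sum, Finset.sum_mul]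
    refine (sum_rot4 _).trans (Finset.sum_congr rfl fun _ _ => ?_)
    refine (sum_rot4 _).trans (Finset.sum_congr rfl fun _ _ => ?_)
    refine (sum_rot4 _).trans (Finset.sum_congr rfl fun _ _ => ?_)
    refine Finset.sum_congr rfl fun _ _ => Finset.sum_congr rfl fun _ _ =>
      Finset.sum_congr rfl fun _ _ => ?_
    ring
  rw [e]
  simp only [← h]
  simp only [slideL, Matrix.mul_apply, Fintype.sum_prod_type, Finset.mul_sum, Finset.sum_mul]
  refine (sum_rot4 _).trans (Finset.sum_congr rfl fun _ _ => ?_)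
  refine (sum_rot4 _).trans (Finset.sum_congr rfl fun _ _ => ?_)
  refine (sum_rot2 _).trans (Finset.sum_congr rfl fun _ _ => ?_)
  refine (sum_rot2 _).trans (Finset.sum_congr rfl fun _ _ => ?_)
  refine (sum_rot2 _).trans (Finset.sum_congr rfl fun _ _ => ?_)
  refine Finset.sum_congr rfl fun _ _ => ?_
  ring

theorem slideR_eq_transpose (Ψ X : M2 N K) :
    slideR Ψ X = (slideL Ψ.transpose X.transpose).transpose := by
  ext ⟨s, u⟩ ⟨q, v⟩
  simp only [slideL, slideR, Matrix.transpose_apply]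
  symm
  refine (sum_rot4 _).trans (Finset.sum_congr rfl fun _ _ => ?_)
  refine Finset.sum_congr rfl fun _ _ => Finset.sum_congr rfl fun _ _ =>
    Finset.sum_congr rfl fun _ _ => ?_
  ring

theorem IsClosedPair.transpose {F Ψ : M2 N K} (hΨ : IsClosedPair F Ψ) :
    IsClosedPair F.transpose Ψ.transpose := by
  intro a b c d
  have := hΨ c d a b
  simp only [Matrix.transpose_apply]
  rw [Finset.sum_comm, this]
  simp only [eq_comm, and_comm]

theorem slideR_mul {X F Ψ : M2 N K} (hΨ : IsClosedPair F Ψ)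
    (hX : TwistRel X.transpose F.transpose) (Y : M2 N K) :
    slideR Ψ (Y * X) = slideR Ψ Y * X := by
  rw [slideR_eq_transpose, slideR_eq_transpose, Matrix.transpose_mul,
    slideL_mul hΨ.transpose hX, Matrix.transpose_mul, Matrix.transpose_transpose]

/-- A one-site operator acting in the first of two factors. -/
def fst (D : Matrix (Fin N) (Fin N) K) : M2 N K := fun i j =>
  D i.1 j.1 * if i.2 = j.2 then 1 else 0

/-- A one-site operator acting in the second of two factors. -/
def snd (D : Matrix (Fin N) (Fin N) K) : M2 N K := fun i j =>
  D i.2 j.2 * if i.1 = j.1 then 1 else 0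

theorem fst_mul_snd (D E : Matrix (Fin N) (Fin N) K) :
    fst D * snd E = fun i j => D i.1 j.1 * E i.2 j.2 := by
  ext ⟨s, u⟩ ⟨q, v⟩
  simp [Matrix.mul_apply, fst, snd, Fintype.sum_prod_type]

theorem snd_mul_fst (D E : Matrix (Fin N) (Fin N) K) :
    snd E * fst D = fun i j => D i.1 j.1 * E i.2 j.2 := by
  ext ⟨s, u⟩ ⟨q, v⟩
  simp [Matrix.mul_apply, fst, snd, Fintype.sum_prod_type, mul_comm]

theorem slideL_one_apply (Ψ : M2 N K) (s u q v : Fin N) :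
    slideL Ψ 1 (s, u) (q, v) = ∑ x, Dmat Ψ s x * Ψ (u, x) (v, q) := by
  simp only [slideL, Matrix.one_apply, Prod.mk.injEq, mul_ite, mul_one, mul_zero]
  simp only [Dmat, Finset.sum_mul]
  have : ∀ a b t : Fin N, (∑ m, if a = m ∧ b = q then
      Ψ (u, t) (v, b) * Ψ (s, m) (t, a) else 0) =
      if b = q then Ψ (u, t) (v, b) * Ψ (s, a) (t, a) else 0 := by
    intro a b t
    by_cases h : b = q <;> simp [h]
  simp only [this]
  refine (sum_rot3 _).trans (Finset.sum_congr rfl fun t _ => Finset.sum_congr rfl fun a _ => ?_)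
  simp [mul_comm]

/-- Multiplying a skew inverse by `D` gives the inverse up to `D`. -/
theorem mul_slideL_one {F Ψ : M2 N K} (hΨ : IsClosedPair F Ψ) (hF : TwistRel F F) :
    F * slideL Ψ 1 = snd (Dmat Ψ) := by
  rw [← slideL_mul hΨ hF, mul_one]
  ext ⟨s, u⟩ ⟨q, v⟩
  simp only [slideL, snd]
  have e : ∑ a, ∑ b, ∑ t, ∑ m, Ψ (u, t) (v, b) * Ψ (s, m) (t, a) * F (a, b) (m, q) =
      ∑ b, ∑ t, Ψ (u, t) (v, b) * ∑ m, ∑ a, Ψ (s, m) (t, a) * F (a, b) (m, q) := by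
    simp only [Finset.mul_sum]
    symm
    refine (sum_rot4 _).trans (Finset.sum_congr rfl fun _ _ => ?_)
    refine Finset.sum_congr rfl fun _ _ => Finset.sum_congr rfl fun _ _ =>
      Finset.sum_congr rfl fun _ _ => ?_
    ring
  rw [e]
  simp only [hΨ s _ _ q, Dmat]
  by_cases h : s = q
  · simp [h]
  · simp [h]

theorem slideL_slideL_one {F Ψ : M2 N K} (hΨ : IsClosedPair F Ψ) (hF : TwistRel F F) :
    F * F * slideL Ψ (slideL Ψ 1) = fst (Dmat Ψ) * snd (Dmat Ψ) := by
  have h : slideL Ψ (snd (Dmat Ψ)) = slideL Ψ 1 * fst (Dmat Ψ) := by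
    ext ⟨s, u⟩ ⟨q, v⟩
    simp only [Matrix.mul_apply, Fintype.sum_prod_type, fst, slideL_one_apply]
    simp only [slideL, snd]
    have e1 : ∀ a b t : Fin N, (∑ m, Ψ (u, t) (v, b) * Ψ (s, m) (t, a) *
        (Dmat Ψ b q * if a = m then 1 else 0)) =
        Ψ (u, t) (v, b) * Dmat Ψ b q * Ψ (s, a) (t, a) := by
      intro a b t
      simp
      ring
    have e2 : ∀ w : Fin N, (∑ z, (∑ x, Dmat Ψ s x * Ψ (u, x) (z, w)) *
        (Dmat Ψ w q * if z = v then 1 else 0)) =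
        ∑ x, Dmat Ψ s x * Ψ (u, x) (v, w) * Dmat Ψ w q := by
      intro w
      simp [Finset.sum_mul]
    simp only [e1, e2]
    rw [Finset.sum_comm]
    refine Finset.sum_congr rfl fun b _ => ?_
    rw [Finset.sum_comm]
    refine Finset.sum_congr rfl fun t _ => ?_
    rw [← Finset.mul_sum]
    change _ * Dmat Ψ s t = _
    ring
  rw [mul_assoc, ← slideL_mul hΨ hF, mul_slideL_one hΨ hF, h, ← mul_assoc, mul_slideL_one hΨ hF,
    snd_mul_fst, fst_mul_snd]

/-- `D ⊗ D` intertwines `R` and its double twist. -/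
theorem fst_mul_snd_mul {R F Ψ : M2 N K} (hΨ : IsClosedPair F Ψ) (hF : TwistRel F F)
    (hFu : IsUnit F)
    (hR : TwistRel R F) (hR' : TwistRel R.transpose F.transpose) :
    fst (Dmat Ψ) * snd (Dmat Ψ) * R = RFF R F * (fst (Dmat Ψ) * snd (Dmat Ψ)) := by
  have h1 : R * slideL Ψ (slideL Ψ 1) = slideL Ψ (slideL Ψ 1) * R := by
    rw [slideL_slideL, ← slideR_mul hΨ hR', ← slideR_mul hΨ hR', ← slideL_slideL,
      ← slideL_mul hΨ hR, ← slideL_mul hΨ hR, mul_one, one_mul, slideL_slideL]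
  have h2 : F⁻¹ * F = 1 := Matrix.nonsing_inv_mul _ ((Matrix.isUnit_iff_isUnit_det _).mp hFu)
  rw [← slideL_slideL_one hΨ hF, mul_assoc (F * F), ← h1, RFF]
  simp only [mul_assoc]
  rw [← mul_assoc F⁻¹ F, h2, one_mul, ← mul_assoc F⁻¹ F, h2, one_mul]

theorem skew_conj {F Ψ : M2 N K} (hΨ : IsClosedPair F Ψ) (hF : TwistRel F F)
    (hFu : IsUnit F) (a b k g : Fin N) :
    ∑ c, ∑ e, ∑ h, Dmat Ψ c e * F (a, e) (g, h) * F⁻¹ (k, h) (b, c) =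
      if a = b then Dmat Ψ k g else 0 := by
  have hG : F⁻¹ * snd (Dmat Ψ) = slideL Ψ 1 := by
    rw [← mul_slideL_one hΨ hF, ← mul_assoc,
      Matrix.nonsing_inv_mul _ ((Matrix.isUnit_iff_isUnit_det _).mp hFu), one_mul]
  have h1 : ∀ h e : Fin N, ∑ c, F⁻¹ (k, h) (b, c) * Dmat Ψ c e =
      ∑ x, Dmat Ψ k x * Ψ (h, x) (e, b) := by
    intro h e
    rw [← slideL_one_apply, ← hG, Matrix.mul_apply, Fintype.sum_prod_type, Finset.sum_comm]
    refine Finset.sum_congr rfl fun c _ => ?_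
    simp [snd]
  have h2 : ∀ e h : Fin N, ∑ c, Dmat Ψ c e * F (a, e) (g, h) * F⁻¹ (k, h) (b, c) =
      ∑ x, Dmat Ψ k x * (F (a, e) (g, h) * Ψ (h, x) (e, b)) := by
    intro e h
    rw [Finset.sum_congr rfl fun x _ => mul_left_comm _ _ _, ← Finset.mul_sum, ← h1,
      Finset.mul_sum]
    exact Finset.sum_congr rfl fun _ _ => by ring
  refine (sum_rot3 _).trans ?_
  rw [Finset.sum_congr rfl fun h _ => Finset.sum_comm,
    Finset.sum_congr rfl fun h _ => Finset.sum_congr rfl fun e _ => h2 e h]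
  refine (sum_rot3 _).trans ?_
  have h3 : ∀ x : Fin N, (∑ h, ∑ e, Dmat Ψ k x * (F (a, e) (g, h) * Ψ (h, x) (e, b))) =
      Dmat Ψ k x * if g = x ∧ a = b then 1 else 0 := by
    intro x
    rw [Finset.sum_comm, ← hΨ.flip]
    simp only [Finset.mul_sum]
  simp only [h3]
  by_cases h : a = b <;> simp [h]

end SkewInverse

section Multiindex

theorem sum_snoc {N m : ℕ} {B : Type*} [AddCommMonoid B] (f : (Fin (m + 1) → Fin N) → B) :
    ∑ a, f a = ∑ a : Fin m → Fin N, ∑ c : Fin N, f (Fin.snoc a c) := by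
  rw [← (Fin.snocEquiv fun _ : Fin (m + 1) => Fin N).sum_comp, Fintype.sum_prod_type,
    Finset.sum_comm]
  rfl

theorem sum_cons {N m : ℕ} {B : Type*} [AddCommMonoid B] (f : (Fin (m + 1) → Fin N) → B) :
    ∑ a, f a = ∑ a : Fin m → Fin N, ∑ c : Fin N, f (Fin.cons c a) := by
  rw [← (Fin.consEquiv fun _ : Fin (m + 1) => Fin N).sum_comp, Fintype.sum_prod_type,
    Finset.sum_comm]
  rfl

theorem snoc_surj {N m : ℕ} (a : Fin (m + 1) → Fin N) : ∃ b c, a = Fin.snoc b c :=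
  ⟨Fin.init a, a (Fin.last m), (Fin.snoc_init_self a).symm⟩

theorem cons_surj {N m : ℕ} (a : Fin (m + 1) → Fin N) : ∃ b c, a = Fin.cons c b :=
  ⟨Fin.tail a, a 0, (Fin.cons_self_tail a).symm⟩

end Multiindex

section Embeddings

variable {K : Type*} [Field K] {A : Type*} [Ring A] [Algebra K A] {N : ℕ}

/-- The matrix `X ⊗ 1`, with a tensor factor added on the right. -/
def extRMat {A : Type*} [Ring A] {N m : ℕ} (X : Op N A m) : Op N A (m + 1) :=
  Matrix.of fun a b => X (Fin.init a) (Fin.init b) * if a (Fin.last m) = b (Fin.last m) then 1 else 0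

theorem extRMat_apply {m : ℕ} (X : Op N A m) (a b : Fin m → Fin N) (x y : Fin N) :
    extRMat X (Fin.snoc a x) (Fin.snoc b y) = X a b * if x = y then 1 else 0 := by
  simp [extRMat]

/-- `X ↦ X ⊗ 1`, adding a tensor factor on the right. -/
def extR (K : Type*) [Field K] {A : Type*} [Ring A] [Algebra K A] {N : ℕ} (m : ℕ) :
    Op N A m →ₐ[K] Op N A (m + 1) :=
  AlgHom.ofLinearMap
    { toFun := extRMat
      map_add' := fun X Y => by ext a b; simp [extRMat, ← ite_add_zero]
      map_smul' := fun c X => by ext a b; simp [extRMat] }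
    (by
      ext a b
      obtain ⟨a, x, rfl⟩ := snoc_surj a
      obtain ⟨b, y, rfl⟩ := snoc_surj b
      change extRMat 1 _ _ = _
      rw [extRMat_apply]
      by_cases h : a = b <;> by_cases h' : x = y <;> simp [Matrix.one_apply, h, h'])
    (fun X Y => by
      ext a b
      obtain ⟨a, x, rfl⟩ := snoc_surj a
      obtain ⟨b, y, rfl⟩ := snoc_surj b
      change extRMat (X * Y) _ _ = (extRMat X * extRMat Y) _ _
      rw [extRMat_apply, Matrix.mul_apply, Matrix.mul_apply, sum_snoc, Finset.sum_mul]
      refine Finset.sum_congr rfl fun c _ => ?_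
      simp only [extRMat_apply]
      by_cases h : x = y <;> simp [h])

/-- The matrix `1 ⊗ X`, with a tensor factor added on the left. -/
def extLMat {A : Type*} [Ring A] {N m : ℕ} (X : Op N A m) : Op N A (m + 1) :=
  Matrix.of fun a b => X (Fin.tail a) (Fin.tail b) * if a 0 = b 0 then 1 else 0

theorem extLMat_apply {m : ℕ} (X : Op N A m) (a b : Fin m → Fin N) (x y : Fin N) :
    extLMat X (Fin.cons x a) (Fin.cons y b) = X a b * if x = y then 1 else 0 := by
  simp [extLMat]

/-- `X ↦ 1 ⊗ X`, adding a tensor factor on the left. -/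
def extL (K : Type*) [Field K] {A : Type*} [Ring A] [Algebra K A] {N : ℕ} (m : ℕ) :
    Op N A m →ₐ[K] Op N A (m + 1) :=
  AlgHom.ofLinearMap
    { toFun := extLMat
      map_add' := fun X Y => by ext a b; simp [extLMat, ← ite_add_zero]
      map_smul' := fun c X => by ext a b; simp [extLMat] }
    (by
      ext a b
      obtain ⟨a, x, rfl⟩ := cons_surj a
      obtain ⟨b, y, rfl⟩ := cons_surj b
      change extLMat 1 _ _ = _
      rw [extLMat_apply]
      by_cases h : a = b <;> by_cases h' : x = y <;> simp [Matrix.one_apply, h, h'])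
    (fun X Y => by
      ext a b
      obtain ⟨a, x, rfl⟩ := cons_surj a
      obtain ⟨b, y, rfl⟩ := cons_surj b
      change extLMat (X * Y) _ _ = (extLMat X * extLMat Y) _ _
      rw [extLMat_apply, Matrix.mul_apply, Matrix.mul_apply, sum_cons, Finset.sum_mul]
      refine Finset.sum_congr rfl fun c _ => ?_
      simp only [extLMat_apply]
      by_cases h : x = y <;> simp [h])

theorem extR_apply {m : ℕ} (X : Op N A m) (a b : Fin m → Fin N) (x y : Fin N) :
    extR K m X (Fin.snoc a x) (Fin.snoc b y) = X a b * if x = y then 1 else 0 :=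
  extRMat_apply X a b x y

theorem extL_apply {m : ℕ} (X : Op N A m) (a b : Fin m → Fin N) (x y : Fin N) :
    extL K m X (Fin.cons x a) (Fin.cons y b) = X a b * if x = y then 1 else 0 :=
  extLMat_apply X a b x y

theorem extR_site {m i : ℕ} (h : i + 1 < m) (X : M2 N A) :
    extR K m (site m i X) = site (m + 1) i X := by
  ext a b
  obtain ⟨a, x, rfl⟩ := snoc_surj a
  obtain ⟨b, y, rfl⟩ := snoc_surj b
  rw [extR_apply]
  have e : ∀ (c : Fin m → Fin N) (z : Fin N) (j : ℕ) (hj : j < m) (hj' : j < m + 1),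
      (Fin.snoc c z : Fin (m + 1) → Fin N) ⟨j, hj'⟩ = c ⟨j, hj⟩ := fun c z j hj hj' =>
    Fin.snoc_castSucc (α := fun _ => Fin N) (i := ⟨j, hj⟩) ..
  simp only [site, h, show i + 1 < m + 1 by omega, dif_pos, mul_assoc]
  rw [e a x i (by omega), e a x (i + 1) h, e b y i (by omega), e b y (i + 1) h]
  congr 1
  simp only [Fin.forall_fin_succ', Fin.snoc_castSucc, Fin.snoc_last, Fin.val_castSucc,
    Fin.val_last]
  have h1 : m ≠ i := by omega
  have h2 : m ≠ i + 1 := by omega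
  by_cases hxy : x = y <;> simp [h1, h2, hxy]

theorem extR_site1 {m i : ℕ} (h : i < m) (X : Matrix (Fin N) (Fin N) A) :
    extR K m (site1 m i X) = site1 (m + 1) i X := by
  ext a b
  obtain ⟨a, x, rfl⟩ := snoc_surj a
  obtain ⟨b, y, rfl⟩ := snoc_surj b
  rw [extR_apply]
  have e : ∀ (c : Fin m → Fin N) (z : Fin N) (j : ℕ) (hj : j < m) (hj' : j < m + 1),
      (Fin.snoc c z : Fin (m + 1) → Fin N) ⟨j, hj'⟩ = c ⟨j, hj⟩ := fun c z j hj hj' =>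
    Fin.snoc_castSucc (α := fun _ => Fin N) (i := ⟨j, hj⟩) ..
  simp only [site1, h, show i < m + 1 by omega, dif_pos, mul_assoc]
  rw [e a x i (by omega), e b y i (by omega)]
  congr 1
  simp only [Fin.forall_fin_succ', Fin.snoc_castSucc, Fin.snoc_last, Fin.val_castSucc,
    Fin.val_last]
  have h1 : m ≠ i := by omega
  by_cases hxy : x = y <;> simp [h1, hxy]

theorem extL_site {m i : ℕ} (h : i + 1 < m) (X : M2 N A) :
    extL K m (site m i X) = site (m + 1) (i + 1) X := by
  ext a b
  obtain ⟨a, x, rfl⟩ := cons_surj a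
  obtain ⟨b, y, rfl⟩ := cons_surj b
  rw [extL_apply]
  have e : ∀ (c : Fin m → Fin N) (z : Fin N) (j : ℕ) (hj : j < m) (hj' : j + 1 < m + 1),
      (Fin.cons z c : Fin (m + 1) → Fin N) ⟨j + 1, hj'⟩ = c ⟨j, hj⟩ := fun c z j hj hj' =>
    Fin.cons_succ (α := fun _ => Fin N) z c ⟨j, hj⟩
  simp only [site, h, show i + 1 + 1 < m + 1 by omega, dif_pos, mul_assoc]
  rw [e a x i (by omega), e a x (i + 1) h, e b y i (by omega), e b y (i + 1) h]
  congr 1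
  simp only [Fin.forall_fin_succ, Fin.cons_succ, Fin.cons_zero, Fin.val_succ,
    Fin.val_zero]
  simp [ite_and, and_comm]

/-- Placing an operator on `n` consecutive factors inside `m` factors. -/
theorem exists_placement (n : ℕ) : ∀ (m i : ℕ), i + n ≤ m →
    ∃ Φ : Op N A n →ₐ[K] Op N A m, ∀ (j : ℕ) (X : M2 N A), j + 1 < n →
      Φ (site n j X) = site m (i + j) X := by
  intro m
  induction m with
  | zero =>
    intro i h
    obtain rfl : n = 0 := by omega
    exact ⟨AlgHom.id K _, fun j X hj => by omega⟩
  | succ m ih =>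
    intro i h
    by_cases h1 : i + n ≤ m
    · obtain ⟨Φ, hΦ⟩ := ih i h1
      refine ⟨(extR K m).comp Φ, fun j X hj => ?_⟩
      rw [AlgHom.comp_apply, hΦ j X hj, extR_site (by omega)]
    · cases i with
      | zero =>
        obtain rfl : n = m + 1 := by omega
        exact ⟨AlgHom.id K _, fun j X hj => by simp⟩
      | succ i =>
        obtain ⟨Φ, hΦ⟩ := ih i (by omega)
        refine ⟨(extL K m).comp Φ, fun j X hj => ?_⟩
        rw [AlgHom.comp_apply, hΦ j X hj, extL_site (by omega)]
        congr 1
        omega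

theorem site_two (X : M2 N A) :
    site 2 0 X = Matrix.reindexAlgEquiv K A (finTwoArrowEquiv (Fin N)).symm X := by
  ext a b
  simp only [site, Matrix.coe_reindexAlgEquiv, Matrix.reindex_apply, Matrix.submatrix_apply]
  simp [finTwoArrowEquiv, Fin.forall_fin_two]

theorem exists_siteHom {m i : ℕ} (h : i + 1 < m) :
    ∃ Φ : M2 N A →ₐ[K] Op N A m, ∀ X : M2 N A, Φ X = site m i X := by
  obtain ⟨Φ, hΦ⟩ := exists_placement (K := K) (A := A) (N := N) 2 m i (by omega)
  refine ⟨Φ.comp (Matrix.reindexAlgEquiv K A (finTwoArrowEquiv (Fin N)).symm).toAlgHom,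
    fun X => ?_⟩
  have := hΦ 0 X (by omega)
  rw [site_two (K := K)] at this
  exact this

theorem site_mul {m i : ℕ} (h : i + 1 < m) (X Y : M2 N K) :
    site m i (X * Y) = site m i X * site m i Y := by
  obtain ⟨Φ, hΦ⟩ := exists_siteHom (K := K) (A := K) (N := N) h
  rw [← hΦ, ← hΦ, ← hΦ, map_mul]

theorem site_one (m i : ℕ) : site m i (1 : M2 N K) = 1 := by
  by_cases h : i + 1 < m
  · obtain ⟨Φ, hΦ⟩ := exists_siteHom (K := K) (A := K) (N := N) h
    rw [← hΦ, map_one]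
  · ext a b
    simp [site, h, Matrix.one_apply]

theorem site_inv_mul {m : ℕ} {F : M2 N K} (hF : IsUnit F) {i : ℕ} (h : i + 1 < m) :
    site m i F⁻¹ * site m i F = 1 := by
  rw [← site_mul h, Matrix.nonsing_inv_mul _ ((Matrix.isUnit_iff_isUnit_det _).mp hF), site_one]

theorem site_mul_inv {m : ℕ} {F : M2 N K} (hF : IsUnit F) {i : ℕ} (h : i + 1 < m) :
    site m i F * site m i F⁻¹ = 1 := by
  rw [← site_mul h, Matrix.mul_nonsing_inv _ ((Matrix.isUnit_iff_isUnit_det _).mp hF), site_one]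

theorem site_quad {m : ℕ} {q : K} {R : M2 N K} (hR : R * R = 1 + (q - q⁻¹) • R) {i : ℕ}
    (h : i + 1 < m) :
    site m i R * site m i R = 1 + (q - q⁻¹) • site m i R := by
  obtain ⟨Φ, hΦ⟩ := exists_siteHom (K := K) (A := K) (N := N) h
  rw [← hΦ, ← map_mul, hR, map_add, map_one, map_smul]

theorem site_triple {m i : ℕ} (h : i + 2 < m) {X Y Z X' Y' Z' : M2 N K}
    (H : site 3 0 X * site 3 1 Y * site 3 0 Z = site 3 1 X' * site 3 0 Y' * site 3 1 Z') :
    site m i X * site m (i + 1) Y * site m i Z =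
      site m (i + 1) X' * site m i Y' * site m (i + 1) Z' := by
  obtain ⟨Φ, hΦ⟩ := exists_placement (K := K) (A := K) (N := N) 3 m i (by omega)
  have := congrArg Φ H
  simpa only [map_mul, hΦ _ _ (show 0 + 1 < 3 by omega), hΦ _ _ (show 1 + 1 < 3 by omega),
    add_zero] using this

theorem site_map (m i : ℕ) (X : M2 N K) :
    site m i (X.map (algebraMap K A)) = (site m i X).map (algebraMap K A) := by
  ext a b
  simp only [site, Matrix.map_apply]
  split_ifs <;> simp

theorem site_last (m : ℕ) (X : M2 N A) (a b : Fin m → Fin N) (x y x' y' : Fin N) :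
    site (m + 2) m X (Fin.snoc (Fin.snoc a x) y) (Fin.snoc (Fin.snoc b x') y') =
      X (x, y) (x', y') * if a = b then 1 else 0 := by
  have e : ∀ (c : Fin m → Fin N) (z w : Fin N),
      (Fin.snoc (Fin.snoc c z : Fin (m + 1) → Fin N) w : Fin (m + 2) → Fin N) ⟨m, by omega⟩ = z :=
    fun c z w => by
      have := Fin.snoc_castSucc (α := fun _ => Fin N) w (Fin.snoc c z : Fin (m + 1) → Fin N)
        (Fin.last m)
      rw [Fin.snoc_last] at this
      exact this
  have e' : ∀ (c : Fin m → Fin N) (z w : Fin N),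
      (Fin.snoc (Fin.snoc c z : Fin (m + 1) → Fin N) w : Fin (m + 2) → Fin N) ⟨m + 1, by omega⟩ =
        w := fun c z w => Fin.snoc_last (α := fun _ => Fin N) ..
  simp only [site, show m + 1 < m + 2 by omega, dif_pos, e, e']
  congr 1
  simp only [Fin.forall_fin_succ', Fin.snoc_castSucc, Fin.snoc_last, Fin.val_castSucc,
    Fin.val_last]
  have h1 : ∀ i : Fin m, (i : ℕ) ≠ m := fun i => i.2.ne
  have h2 : ∀ i : Fin m, (i : ℕ) ≠ m + 1 := fun i => (i.2.trans (Nat.lt_succ_self m)).ne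
  simp [h1, h2, funext_iff]

end Embeddings

section Commutation

variable {K : Type*} [Field K] {A : Type*} [Ring A] [Algebra K A] {N : ℕ}

/-- Extension of scalars for operators. -/
abbrev opMap (K : Type*) [Field K] (A : Type*) [Ring A] [Algebra K A] (N m : ℕ) :
    Op N K m →ₐ[K] Op N A m :=
  (Algebra.ofId K A).mapMatrix

theorem opMap_apply {m : ℕ} (X : Op N K m) : opMap K A N m X = X.map (algebraMap K A) := rfl

theorem opMap_site (m i : ℕ) (X : M2 N K) :
    opMap K A N m (site m i X) = site m i (X.map (algebraMap K A)) :=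
  (site_map m i X).symm

theorem commute_extR_extR_site {j : ℕ} (Z : Op N A j) (Y : M2 N K) :
    Commute (extR K (j + 1) (extR K j Z)) (site (j + 2) j (Y.map (algebraMap K A))) := by
  ext a b
  obtain ⟨a, y, rfl⟩ := snoc_surj a
  obtain ⟨a, x, rfl⟩ := snoc_surj a
  obtain ⟨b, y', rfl⟩ := snoc_surj b
  obtain ⟨b, x', rfl⟩ := snoc_surj b
  simp only [Matrix.mul_apply, sum_snoc, extR_apply, site_last, Matrix.map_apply]
  have h1 : ∑ c : Fin j → Fin N, ∑ d, ∑ e, (Z a c * (if x = d then 1 else 0) * (if y = e then 1 else 0)) *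
      (algebraMap K A (Y (d, e) (x', y')) * if c = b then 1 else 0) =
      Z a b * algebraMap K A (Y (x, y) (x', y')) := by
    simp
  have h2 : ∑ c : Fin j → Fin N, ∑ d, ∑ e, (algebraMap K A (Y (x, y) (d, e)) * if a = c then 1 else 0) *
      (Z c b * (if d = x' then 1 else 0) * (if e = y' then 1 else 0)) =
      algebraMap K A (Y (x, y) (x', y')) * Z a b := by
    simp
  rw [h1, h2, Algebra.commutes]

theorem Mbar_extR (m : ℕ) (F Finv : M2 N A) (M : Matrix (Fin N) (Fin N) A) :
    ∀ {k : ℕ}, k < m → extR K m (Mbar m F Finv M k) = Mbar (m + 1) F Finv M k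
  | 0, h => extR_site1 h M
  | k + 1, h => by
    rw [Mbar, Mbar, map_mul, map_mul, extR_site h, extR_site h, Mbar_extR m F Finv M (by omega)]

theorem chain_extR (m : ℕ) (X : M2 N A) (i : ℕ) :
    ∀ {l : ℕ}, i + l < m → extR K m (chain m X i l) = chain (m + 1) X i l
  | 0, _ => map_one _
  | l + 1, h => by
    rw [chain, chain, map_mul, extR_site (by omega), chain_extR m X i (by omega)]

theorem MbarSeg_extR (m : ℕ) (F Finv : M2 N A) (M : Matrix (Fin N) (Fin N) A) (i : ℕ) :
    ∀ {l : ℕ}, i + l ≤ m → extR K m (MbarSeg m F Finv M i l) = MbarSeg (m + 1) F Finv M i l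
  | 0, _ => map_one _
  | l + 1, h => by
    rw [MbarSeg, MbarSeg, map_mul, Mbar_extR _ _ _ _ (by omega), MbarSeg_extR m F Finv M i (by omega)]

theorem Mbar_commute_site (F Finv : M2 N A) (M : Matrix (Fin N) (Fin N) A) (Y : M2 N K) {j k : ℕ}
    (hk : k < j) : ∀ {m : ℕ}, j + 1 < m →
    Commute (Mbar m F Finv M k) (site m j (Y.map (algebraMap K A))) := by
  intro m hm
  induction m, hm using Nat.le_induction with
  | base =>
    rw [← Mbar_extR (K := K) _ _ _ _ (show k < j + 1 by omega),
      ← Mbar_extR (K := K) _ _ _ _ hk]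
    exact commute_extR_extR_site _ _
  | succ m hm ih =>
    rw [← Mbar_extR (K := K) _ _ _ _ (show k < m by omega), ← extR_site (K := K) (by omega)]
    exact ih.map (extR K m)

theorem site_commute_site (X : M2 N A) (Y : M2 N K) {i j : ℕ} (hi : i + 1 < j) :
    ∀ {m : ℕ}, j + 1 < m →
    Commute (site m i X) (site m j (Y.map (algebraMap K A))) := by
  intro m hm
  induction m, hm using Nat.le_induction with
  | base =>
    rw [← extR_site (K := K) (show i + 1 < j + 1 by omega), ← extR_site (K := K) hi]
    exact commute_extR_extR_site _ _
  | succ m hm ih =>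
    rw [← extR_site (K := K) (show i + 1 < m by omega), ← extR_site (K := K) (by omega)]
    exact ih.map (extR K m)

end Commutation

section Traces

variable {K : Type*} [Field K] {A : Type*} [Ring A] [Algebra K A] {N : ℕ}

theorem qtrAll_qtr1 (D : Matrix (Fin N) (Fin N) K) {m : ℕ} (X : Op N A (m + 1)) :
    qtrAll D (qtr1 D X) = qtrAll D X := by
  simp only [qtrAll, qtr1, sum_snoc, Fin.prod_univ_castSucc, Fin.snoc_castSucc, Fin.snoc_last,
    map_mul, Finset.mul_sum]
  refine Finset.sum_congr rfl fun a _ => ?_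
  rw [Finset.sum_comm]
  exact Finset.sum_congr rfl fun _ _ => Finset.sum_congr rfl fun _ _ =>
    Finset.sum_congr rfl fun _ _ => (mul_assoc _ _ _).symm

theorem qtr1_extR_mul (D : Matrix (Fin N) (Fin N) K) {m : ℕ} (Y : Op N A m) (X : Op N A (m + 1)) :
    qtr1 D (extR K m Y * X) = Y * qtr1 D X := by
  ext a b
  simp only [qtr1, Matrix.mul_apply, sum_snoc, extR_apply, Finset.mul_sum]
  have h : ∀ (c e : Fin N) (a' : Fin m → Fin N), (∑ z, algebraMap K A (D c e) *
      ((Y a a' * if e = z then 1 else 0) * X (Fin.snoc a' z) (Fin.snoc b c))) =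
      Y a a' * (algebraMap K A (D c e) * X (Fin.snoc a' e) (Fin.snoc b c)) := by
    intro c e a'
    rw [Finset.sum_eq_single e (fun z _ hz => by simp [hz.symm]) (by simp)]
    rw [if_pos rfl, mul_one, ← mul_assoc, ← mul_assoc, Algebra.commutes]
  simp only [h]
  rw [Finset.sum_congr rfl fun _ _ => Finset.sum_comm, Finset.sum_comm]

theorem qtr1_mul_extR (D : Matrix (Fin N) (Fin N) K) {m : ℕ} (Y : Op N A m) (X : Op N A (m + 1)) :
    qtr1 D (X * extR K m Y) = qtr1 D X * Y := by
  ext a b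
  simp only [qtr1, Matrix.mul_apply, sum_snoc, extR_apply, Finset.sum_mul, Finset.mul_sum]
  have h : ∀ (c e : Fin N) (a' : Fin m → Fin N), (∑ z, algebraMap K A (D c e) *
      (X (Fin.snoc a e) (Fin.snoc a' z) * (Y a' b * if z = c then 1 else 0))) =
      algebraMap K A (D c e) * X (Fin.snoc a e) (Fin.snoc a' c) * Y a' b := by
    intro c e a'
    rw [Finset.sum_eq_single c (fun z _ hz => by simp [hz]) (by simp)]
    simp only [if_true, mul_one, ← mul_assoc]
  simp only [h]
  rw [Finset.sum_congr rfl fun _ _ => Finset.sum_comm, Finset.sum_comm]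

theorem qtr1_conj {F Ψ : M2 N K} (hΨ : IsClosedPair F Ψ) (hF : TwistRel F F)
    (hFu : IsUnit F) {m : ℕ} (X : Op N A (m + 1)) :
    qtr1 (Dmat Ψ) (site (m + 2) m (F.map (algebraMap K A)) * extR K (m + 1) X *
      site (m + 2) m (F⁻¹.map (algebraMap K A))) = extR K m (qtr1 (Dmat Ψ) X) := by
  ext a b
  obtain ⟨a, x, rfl⟩ := snoc_surj a
  obtain ⟨b, y, rfl⟩ := snoc_surj b
  simp only [qtr1, Matrix.mul_apply, sum_snoc, extR_apply, site_last, Matrix.map_apply]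
  have h1 : ∀ (e h g : Fin N) (p : Fin m → Fin N),
      (∑ a', ∑ u, ∑ v, (algebraMap K A (F (x, e) (u, v)) * if a = a' then 1 else 0) *
        (X (Fin.snoc a' u) (Fin.snoc p g) * if v = h then 1 else 0)) =
      ∑ u, algebraMap K A (F (x, e) (u, h)) * X (Fin.snoc a u) (Fin.snoc p g) := by
    intro e h g p
    rw [Finset.sum_eq_single a (fun z _ hz => by simp [hz.symm]) (by simp)]
    refine Finset.sum_congr rfl fun u _ => ?_
    rw [Finset.sum_eq_single h (fun z _ hz => by simp [hz]) (by simp)]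
    simp
  have h2 : ∀ c e : Fin N, (∑ p, ∑ g, ∑ h,
      (∑ u, algebraMap K A (F (x, e) (u, h)) * X (Fin.snoc a u) (Fin.snoc p g)) *
        (algebraMap K A (F⁻¹ (g, h) (y, c)) * if p = b then 1 else 0)) =
      ∑ g, ∑ h, ∑ u, algebraMap K A (F (x, e) (u, h) * F⁻¹ (g, h) (y, c)) *
        X (Fin.snoc a u) (Fin.snoc b g) := by
    intro c e
    rw [Finset.sum_eq_single b (fun z _ hz => by simp [hz]) (by simp)]
    refine Finset.sum_congr rfl fun g _ => Finset.sum_congr rfl fun h _ => ?_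
    rw [Finset.sum_mul]
    refine Finset.sum_congr rfl fun u _ => ?_
    rw [if_pos rfl, mul_one, map_mul, mul_assoc, mul_assoc, ← Algebra.commutes]
  simp only [h1, h2]
  have h3 : ∀ g u : Fin N, (∑ c, ∑ e, ∑ h, algebraMap K A (Dmat Ψ c e) *
      (algebraMap K A (F (x, e) (u, h) * F⁻¹ (g, h) (y, c)) *
        X (Fin.snoc a u) (Fin.snoc b g))) =
      algebraMap K A (Dmat Ψ g u) * X (Fin.snoc a u) (Fin.snoc b g) *
        if x = y then 1 else 0 := by
    intro g u
    have := congrArg (algebraMap K A) (skew_conj hΨ hF hFu x y g u)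
    simp only [map_sum, map_mul] at this
    simp only [map_mul, ← mul_assoc, ← Finset.sum_mul, this]
    split_ifs <;> simp
  simp only [Finset.mul_sum, Finset.sum_mul, ← h3]
  refine (sum_rot5 _).trans ?_
  rw [Finset.sum_congr rfl fun _ _ => sum_rot3 _]
  exact Finset.sum_comm

end Traces

section Compat

variable {K : Type*} [Field K] {N : ℕ}

theorem fst_mul_snd_apply (D E : Matrix (Fin N) (Fin N) K) (x y z w : Fin N) :
    (fst D * snd E) (x, y) (z, w) = D x z * E y w := by
  simp [Matrix.mul_apply, fst, snd, Fintype.sum_prod_type]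

theorem sum_three {B : Type*} [AddCommMonoid B] (f : (Fin 3 → Fin N) → B) :
    ∑ a, f a = ∑ x, ∑ y, ∑ z, f ![x, y, z] := by
  rw [sum_cons]
  simp only [sum_cons (m := 1), sum_cons (m := 0), Fintype.sum_unique]
  rw [sum_rot3, Finset.sum_congr rfl fun _ _ => Finset.sum_comm]
  refine Finset.sum_congr rfl fun x _ => Finset.sum_congr rfl fun y _ =>
    Finset.sum_congr rfl fun z _ => ?_
  congr 1

theorem site_three_zero (X : M2 N K) (a b c d e f : Fin N) :
    site 3 0 X ![a, b, c] ![d, e, f] = X (a, b) (d, e) * if c = f then 1 else 0 := by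
  simp [site, Fin.forall_fin_succ]

theorem site_three_one (X : M2 N K) (a b c d e f : Fin N) :
    site 3 1 X ![a, b, c] ![d, e, f] = X (b, c) (e, f) * if a = d then 1 else 0 := by
  simp [site, Fin.forall_fin_succ]

theorem twistRel_of_site {X F : M2 N K}
    (H : site 3 0 X * site 3 1 F * site 3 0 F = site 3 1 F * site 3 0 F * site 3 1 X) :
    TwistRel X F := by
  intro a b c d e f
  have h := congrFun (congrFun H ![a, b, c]) ![d, e, f]
  simp only [Matrix.mul_apply, sum_three, site_three_zero, site_three_one] at h
  simp only [mul_ite, mul_one, mul_zero, ite_mul, zero_mul, Finset.sum_ite_eq,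
    Finset.sum_ite_eq', Finset.mem_univ, if_true, Finset.sum_mul, Finset.sum_ite_irrel,
    Finset.sum_const_zero] at h
  rw [Finset.sum_congr rfl fun _ _ => Finset.sum_comm, h, sum_rot3]
  exact Finset.sum_congr rfl fun _ _ => Finset.sum_comm

theorem site_transpose (m i : ℕ) (X : M2 N K) :
    site m i X.transpose = (site m i X).transpose := by
  ext a b
  simp only [site, Matrix.transpose_apply, eq_comm]

theorem Compatible.twistRel {R F : M2 N K} (h : Compatible R F) : TwistRel R F :=
  twistRel_of_site h.2.2.1

theorem Compatible.twistRel_self {R F : M2 N K} (h : Compatible R F) : TwistRel F F :=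
  twistRel_of_site h.2.1

theorem Compatible.twistRel_transpose {R F : M2 N K} (h : Compatible R F) :
    TwistRel R.transpose F.transpose := by
  apply twistRel_of_site
  simp only [site_transpose, ← Matrix.transpose_mul, ← mul_assoc]
  rw [h.2.2.2]

end Compat

section Cyclic

variable {K : Type*} [Field K] {A : Type*} [Ring A] [Algebra K A] {N : ℕ}

/-- The operator `D ⊗ ⋯ ⊗ D`. -/
def tensPow (D : Matrix (Fin N) (Fin N) K) (m : ℕ) : Op N K m :=
  Matrix.of fun a b => ∏ i, D (a i) (b i)

theorem tensPow_snoc (D : Matrix (Fin N) (Fin N) K) (m : ℕ) (a b : Fin m → Fin N) (x y : Fin N) :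
    tensPow D (m + 1) (Fin.snoc a x) (Fin.snoc b y) = tensPow D m a b * D x y := by
  simp [tensPow, Fin.prod_univ_castSucc]

theorem tensPow_mul_site {D : Matrix (Fin N) (Fin N) K} {X Y : M2 N K}
    (h : fst D * snd D * X = Y * (fst D * snd D)) {m i : ℕ} (hi : i + 1 < m) :
    tensPow D m * site m i X = site m i Y * tensPow D m := by
  induction m, hi using Nat.le_induction with
  | base =>
    ext a b
    obtain ⟨a, y, rfl⟩ := snoc_surj a
    obtain ⟨a, x, rfl⟩ := snoc_surj a
    obtain ⟨b, y', rfl⟩ := snoc_surj b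
    obtain ⟨b, x', rfl⟩ := snoc_surj b
    simp only [Matrix.mul_apply, sum_snoc]
    have h' := congrFun (congrFun h (x, y)) (x', y')
    rw [Matrix.mul_apply, Matrix.mul_apply, Fintype.sum_prod_type,
      Fintype.sum_prod_type] at h'
    simp only [fst_mul_snd_apply] at h'
    have e1 := congrArg (fun z => tensPow D i a b * z) h'
    simp only [Finset.mul_sum] at e1
    simp only [Nat.succ_eq_add_one, site_last, tensPow_snoc]
    rw [Finset.sum_eq_single b (fun z _ hz => by simp [hz]) (by simp),
      Finset.sum_eq_single a (fun z _ hz => by simp [hz.symm]) (by simp)]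
    refine Eq.trans ?_ (e1.trans ?_)
    · refine Finset.sum_congr rfl fun _ _ => Finset.sum_congr rfl fun _ _ => ?_
      rw [if_pos rfl]
      ring
    · refine Finset.sum_congr rfl fun _ _ => Finset.sum_congr rfl fun _ _ => ?_
      rw [if_pos rfl]
      ring
  | succ m hm ih =>
    rw [← extR_site (K := K) (by omega), ← extR_site (K := K) (by omega)]
    ext a b
    obtain ⟨a, x, rfl⟩ := snoc_surj a
    obtain ⟨b, y, rfl⟩ := snoc_surj b
    simp only [Matrix.mul_apply, sum_snoc, extR_apply, tensPow_snoc]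
    have e := congrFun (congrFun ih a) b
    rw [Matrix.mul_apply, Matrix.mul_apply] at e
    simp only [mul_ite, mul_one, mul_zero, ite_mul, zero_mul, Finset.sum_ite_eq,
      Finset.sum_ite_eq', Finset.mem_univ, if_true]
    have e' := congrArg (fun z => z * D x y) e
    simp only [Finset.sum_mul] at e'
    refine Eq.trans ?_ (e'.trans ?_)
    · exact Finset.sum_congr rfl fun _ _ => by ring
    · exact Finset.sum_congr rfl fun _ _ => by ring

theorem qtrAll_eq_trace (D : Matrix (Fin N) (Fin N) K) {m : ℕ} (X : Op N A m) :
    qtrAll D X = Matrix.trace (opMap K A N m (tensPow D m) * X) := by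
  simp [qtrAll, Matrix.trace, Matrix.mul_apply, tensPow]

theorem trace_opMap_mul {m : ℕ} (X : Op N K m) (Y : Op N A m) :
    Matrix.trace (opMap K A N m X * Y) = Matrix.trace (Y * opMap K A N m X) := by
  simp only [Matrix.trace, Matrix.diag, Matrix.mul_apply, opMap_apply, Matrix.map_apply]
  rw [Finset.sum_comm]
  exact Finset.sum_congr rfl fun _ _ => Finset.sum_congr rfl fun _ _ => Algebra.commutes _ _

theorem qtrAll_site_mul {R F Ψ : M2 N K} (hΨ : IsClosedPair F Ψ) (hFu : IsUnit F)
    (h : Compatible R F) {m i : ℕ} (hi : i + 1 < m) (X : Op N A m) :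
    qtrAll (Dmat Ψ) (opMap K A N m (site m i R) * X) =
      qtrAll (Dmat Ψ) (X * opMap K A N m (site m i (RFF R F))) := by
  rw [qtrAll_eq_trace, qtrAll_eq_trace, ← mul_assoc, ← map_mul,
    tensPow_mul_site (fst_mul_snd_mul hΨ h.twistRel_self hFu h.twistRel h.twistRel_transpose) hi,
    map_mul, mul_assoc, trace_opMap_mul, mul_assoc]

end Cyclic

section TwistedFamily

variable {B : Type*} [Ring B]

/-- The product `x p * x (p + 1) * ⋯ * x (p + l - 1)`. -/
def run (x : ℕ → B) (p : ℕ) : ℕ → B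
  | 0 => 1
  | l + 1 => run x p l * x (p + l)

theorem run_add (x : ℕ → B) (p l : ℕ) : ∀ l', run x p (l + l') = run x p l * run x (p + l) l'
  | 0 => (mul_one _).symm
  | l' + 1 => by
    rw [← add_assoc, run, run_add x p l l', run, add_assoc p, mul_assoc]

theorem run_comm {x : ℕ → B} {p l : ℕ} {y : B} (h : ∀ i, p ≤ i → i < p + l → Commute y (x i)) :
    Commute y (run x p l) := by
  induction l with
  | zero => exact Commute.one_right y
  | succ l ih =>
    exact (ih fun i hi hi' => h i hi (by omega)).mul_right (h _ (by omega) (by omega))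

theorem SemiconjBy.run {x : ℕ → B} {c : B} {p l : ℕ}
    (h : ∀ i, p ≤ i → i < p + l → SemiconjBy c (x i) (x (i + 1))) :
    SemiconjBy c (run x p l) (run x (p + 1) l) := by
  induction l with
  | zero => exact SemiconjBy.one_right c
  | succ l ih =>
    rw [CHN.run, CHN.run, add_right_comm p 1 l]
    exact (ih fun i hi hi' => h i hi (by omega)).mul_right (h _ (by omega) (by omega))

theorem SemiconjBy.eq_of_eq {P : Bˣ} {a a' b b' : B} (ha : SemiconjBy (P : B) a a')
    (hb : SemiconjBy (P : B) b b') (h : a = b) : a' = b' := by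
  have : a' * P = b' * P := by rw [← ha.eq, ← hb.eq, h]
  exact (Units.mul_left_inj P).mp this

/-- Abstract relations between the `g i = R̂ᵢ`, the `f i = F̂ᵢ` and the copies `μ i` of the
matrix of generators. -/
structure IsTwistedFamily (f : ℕ → Bˣ) (g r μ : ℕ → B) (m : ℕ) : Prop where
  braid : ∀ i, i + 2 < m → (f i : B) * f (i + 1) * f i = f (i + 1) * f i * f (i + 1)
  twist : ∀ i, i + 2 < m → g i * f (i + 1) * f i = f (i + 1) * f i * g (i + 1)
  twist' : ∀ i, i + 2 < m → f i * f (i + 1) * g i = g (i + 1) * f i * f (i + 1)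
  comm_ff : ∀ i j, i + 1 < j → j + 1 < m → Commute (f i : B) (f j)
  comm_fg : ∀ i j, i + 1 < j → j + 1 < m → Commute (f i : B) (g j)
  comm_gf : ∀ i j, i + 1 < j → j + 1 < m → Commute (g i) (f j : B)
  double_twist : ∀ i, i + 1 < m → r i = f i * (f i * g i * ↑(f i)⁻¹) * ↑(f i)⁻¹
  conj_copy : ∀ i, i + 1 < m → SemiconjBy (f i : B) (μ i) (μ (i + 1))
  comm_copy_f : ∀ i j, i < j → j + 1 < m → Commute (μ i) (f j : B)
  comm_copy_g : ∀ i j, i < j → j + 1 < m → Commute (μ i) (g j)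
  rtt : 1 < m → g 0 * (μ 0 * μ 1) = μ 0 * μ 1 * r 0

namespace IsTwistedFamily

variable {f : ℕ → Bˣ} {g r μ : ℕ → B} {m : ℕ} (H : IsTwistedFamily f g r μ m)
include H

theorem commute_copy {x : ℕ → B} {i : ℕ}
    (hx : i + 2 < m → x i * f (i + 1) * f i = f (i + 1) * f i * x (i + 1))
    (hμ : i + 2 < m → Commute (μ i) (x (i + 1)))
    (hf : ∀ j, i + 1 < j → j + 1 < m → Commute (x i) (f j : B)) :
    ∀ j, i + 2 ≤ j → j < m → Commute (x i) (μ j) := by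
  intro j hj
  induction j, hj using Nat.le_induction with
  | base =>
    intro hm
    have h1 : SemiconjBy ((f (i + 1) * f i : Bˣ) : B) (x (i + 1)) (x i) := by
      rw [SemiconjBy, Units.val_mul, ← hx hm, mul_assoc]
    have h2 : SemiconjBy ((f (i + 1) * f i : Bˣ) : B) (μ i) (μ (i + 2)) := by
      rw [Units.val_mul]
      exact (H.conj_copy (i + 1) (by omega)).mul_left (H.conj_copy i (by omega))
    exact SemiconjBy.eq_of_eq (h1.mul_right h2) (h2.mul_right h1) (hμ hm).symm.eq
  | succ j hj ih =>
    intro hm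
    have h := hf j (by omega) hm
    exact SemiconjBy.eq_of_eq (SemiconjBy.mul_right h.symm (H.conj_copy j hm))
      ((H.conj_copy j hm).mul_right h.symm) (ih (by omega)).eq

theorem commute_f_copy (i j : ℕ) (hij : i + 2 ≤ j) (hj : j < m) : Commute (f i : B) (μ j) :=
  H.commute_copy (x := fun i => (f i : B)) (fun h => H.braid i h) (fun h => H.comm_copy_f _ _ (by omega) h)
    (H.comm_ff i) j hij hj

theorem commute_g_copy (i j : ℕ) (hij : i + 2 ≤ j) (hj : j < m) : Commute (g i) (μ j) :=
  H.commute_copy (x := g) (H.twist i) (fun h => H.comm_copy_g _ _ (by omega) h)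
    (H.comm_gf i) j hij hj

theorem commute_r_copy (i j : ℕ) (hij : i + 2 ≤ j) (hj : j < m) : Commute (r i) (μ j) := by
  rw [H.double_twist i (by omega)]
  have hf := H.commute_f_copy i j hij hj
  have hg := H.commute_g_copy i j hij hj
  exact ((hf.mul_left ((hf.mul_left hg).mul_left hf.units_inv_left))).mul_left hf.units_inv_left

theorem rtt_copy (i : ℕ) (hi : i + 1 < m) : g i * (μ i * μ (i + 1)) = μ i * μ (i + 1) * r i := by
  induction i with
  | zero => exact H.rtt hi
  | succ i ih =>
    have hf : SemiconjBy ((f i * f (i + 1) : Bˣ) : B) (f i) (f (i + 1)) := by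
      rw [SemiconjBy, Units.val_mul, H.braid i hi, mul_assoc]
    have hg : SemiconjBy ((f i * f (i + 1) : Bˣ) : B) (g i) (g (i + 1)) := by
      rw [SemiconjBy, Units.val_mul, H.twist' i hi, mul_assoc]
    have hr : SemiconjBy ((f i * f (i + 1) : Bˣ) : B) (r i) (r (i + 1)) := by
      rw [H.double_twist i (by omega), H.double_twist (i + 1) hi]
      exact (hf.mul_right ((hf.mul_right hg).mul_right hf.units_inv_right)).mul_right
        hf.units_inv_right
    have h1 : SemiconjBy ((f i * f (i + 1) : Bˣ) : B) (μ i) (μ (i + 1)) := by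
      rw [Units.val_mul]
      exact (H.conj_copy i (by omega)).mul_left (H.comm_copy_f i (i + 1) (by omega) hi).symm
    have h2 : SemiconjBy ((f i * f (i + 1) : Bˣ) : B) (μ (i + 1)) (μ (i + 2)) := by
      change _ * _ = _ * _
      refine (Units.mul_left_inj (f i)).mp ?_
      rw [mul_assoc, ← (H.conj_copy i (by omega)).eq, ← mul_assoc, hf.eq, mul_assoc, h1.eq,
        ← mul_assoc, (H.conj_copy (i + 1) hi).eq, mul_assoc, ← hf.eq, mul_assoc]
    exact SemiconjBy.eq_of_eq (hg.mul_right (h1.mul_right h2)) ((h1.mul_right h2).mul_right hr)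
      (ih (by omega))

theorem g_mul_run_copy (i : ℕ) : ∀ n, i + 1 < n → n ≤ m → g i * run μ 0 n = run μ 0 n * r i := by
  intro n hn
  induction n, hn using Nat.le_induction with
  | base =>
    intro hm
    have h : Commute (g i) (run μ 0 i) := run_comm fun j _ hj =>
      (H.comm_copy_g j i (by omega) (by omega)).symm
    simp only [run, zero_add]
    rw [mul_assoc (run μ 0 i), ← mul_assoc, h.eq, mul_assoc, H.rtt_copy i (by omega), mul_assoc,
      mul_assoc, mul_assoc]
  | succ n hn ih =>
    intro hm
    rw [run, ← mul_assoc, ih (by omega), mul_assoc, mul_assoc, zero_add,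
      (H.commute_r_copy i n (by omega) (by omega)).eq]

theorem run_f_semiconj_copy (p l : ℕ) (hl : p + l < m) :
    ∀ j, p ≤ j → j < p + l → SemiconjBy (run (fun i => (f i : B)) p l) (μ j) (μ (j + 1)) := by
  induction l with
  | zero => intro j h1 h2; omega
  | succ l ih =>
    intro j h1 h2
    rw [run]
    by_cases hj : j < p + l
    · exact (ih (by omega) j h1 hj).mul_left (H.comm_copy_f j (p + l) hj (by omega)).symm
    · obtain rfl : j = p + l := by omega
      refine SemiconjBy.mul_left (y := μ (p + l + 1)) ?_ (H.conj_copy _ (by omega))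
      exact (run_comm fun i _ hi => (H.commute_f_copy i _ (by omega) (by omega)).symm).symm

theorem run_f_semiconj_g (p l : ℕ) (hl : p + l < m) :
    ∀ j, p ≤ j → j + 1 < p + l → SemiconjBy (run (fun i => (f i : B)) p l) (g j) (g (j + 1)) := by
  induction l with
  | zero => intro j h1 h2; omega
  | succ l ih =>
    intro j h1 h2
    rw [run]
    by_cases hj : j + 1 < p + l
    · exact (ih (by omega) j h1 hj).mul_left (H.comm_gf j (p + l) hj (by omega)).symm
    · obtain ⟨l, rfl⟩ : ∃ l', l = l' + 1 := ⟨l - 1, by omega⟩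
      obtain rfl : j = p + l := by omega
      rw [run, mul_assoc]
      refine SemiconjBy.mul_left (y := g (p + l + 1)) ?_ ?_
      · exact (run_comm fun i _ hi => (H.comm_fg i _ (by omega) (by omega)).symm).symm
      · exact (H.twist' (p + l) (by omega)).trans (mul_assoc _ _ _)

end IsTwistedFamily

theorem SemiconjBy.asym {K : Type*} [Field K] [Algebra K B] (q : K) {g : ℕ → B} {c : B} {p : ℕ} :
    ∀ {k : ℕ}, (∀ i, p ≤ i → i + 1 < p + k → SemiconjBy c (g i) (g (i + 1))) →
      SemiconjBy c (asym q g p k) (asym q g (p + 1) k)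
  | 0, _ => SemiconjBy.one_right c
  | 1, _ => SemiconjBy.one_right c
  | k + 2, h => by
    have ih := SemiconjBy.asym q (k := k + 1) fun i hi hi' => h i hi (by omega)
    have hg := h (p + k) (by omega) (by omega)
    rw [CHN.asym, CHN.asym, add_right_comm p 1 k]
    refine SemiconjBy.smul_right ?_ _
    refine (ih.mul_right ?_).mul_right ih
    exact (SemiconjBy.smul_right (SemiconjBy.one_right c) _).sub_right (hg.smul_right _)

theorem map_asym {K : Type*} [Field K] [Algebra K B] {B' : Type*} [Ring B'] [Algebra K B']
    (φ : B →ₐ[K] B') (q : K) (g : ℕ → B) (p : ℕ) :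
    ∀ k, φ (asym q g p k) = asym q (fun i => φ (g i)) p k
  | 0 => map_one φ
  | 1 => map_one φ
  | k + 2 => by
    simp only [asym, map_smul, map_mul, map_sub, map_one, map_asym φ q g p (k + 1)]

end TwistedFamily

section PartialTrace

variable {K : Type*} [Field K] {A : Type*} [Ring A] [Algebra K A] {N : ℕ}

/-- `IsPartialTrace D m p X Y` says that `Y` is the quantum trace of the operator `X` on `m`
factors over all factors but the first `p`. -/
inductive IsPartialTrace (D : Matrix (Fin N) (Fin N) K) :
    (m p : ℕ) → Op N A m → Op N A p → Prop
  | refl (m : ℕ) (X : Op N A m) : IsPartialTrace D m m X X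
  | step (m p : ℕ) (X : Op N A (m + 1)) (Y : Op N A p) (h : IsPartialTrace D m p (qtr1 D X) Y) :
      IsPartialTrace D (m + 1) p X Y

/-- The product `site (p + l - 1) * ⋯ * site p`, in the order opposite to `chain`. -/
def revChain {A : Type*} [Ring A] {N : ℕ} (m : ℕ) (X : M2 N A) (p : ℕ) : ℕ → Op N A m
  | 0 => 1
  | l + 1 => site m (p + l) X * revChain m X p l

theorem revChain_extR (m : ℕ) (X : M2 N A) (i : ℕ) :
    ∀ {l : ℕ}, i + l < m → extR K m (revChain m X i l) = revChain (m + 1) X i l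
  | 0, _ => map_one _
  | l + 1, h => by
    rw [revChain, revChain, map_mul, extR_site (by omega), revChain_extR m X i (by omega)]

namespace IsPartialTrace

variable {D : Matrix (Fin N) (Fin N) K}

theorem le {m p : ℕ} {X : Op N A m} {Y : Op N A p} (h : IsPartialTrace D m p X Y) : p ≤ m := by
  induction h with
  | refl => exact le_rfl
  | step m p X Y h ih => omega

theorem qtrAll_eq {m p : ℕ} {X : Op N A m} {Y : Op N A p} (h : IsPartialTrace D m p X Y) :
    qtrAll D X = qtrAll D Y := by
  induction h with
  | refl => rfl
  | step m p X Y h ih => rw [← ih, qtrAll_qtr1]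

theorem scalar (D : Matrix (Fin N) (Fin N) K) :
    ∀ {m : ℕ} (X : Op N A m),
      IsPartialTrace D m 0 X (Matrix.diagonal fun _ => qtrAll D X)
  | 0, X => by
    convert IsPartialTrace.refl 0 X
    ext a b
    obtain rfl : a = b := Subsingleton.elim _ _
    rw [Matrix.diagonal_apply_eq]
    simp [qtrAll, Subsingleton.elim _ a]
  | m + 1, X => by
    refine .step m 0 X _ ?_
    rw [← qtrAll_qtr1]
    exact scalar D (qtr1 D X)

theorem mul_left {m p : ℕ} {X : Op N A m} {Y : Op N A p} (h : IsPartialTrace D m p X Y)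
    (U : (n : ℕ) → Op N A n) (hU : ∀ n, p ≤ n → extR K n (U n) = U (n + 1)) :
    IsPartialTrace D m p (U m * X) (U p * Y) := by
  induction h with
  | refl m X => exact .refl _ _
  | step m p X Y h ih =>
    refine .step m p _ _ ?_
    rw [← hU m h.le, qtr1_extR_mul]
    exact ih hU

theorem conj {F Ψ : M2 N K} (hΨ : IsClosedPair F Ψ) (hF : TwistRel F F) (hFu : IsUnit F)
    {m p : ℕ} {X : Op N A m} {Y : Op N A p} (h : IsPartialTrace (Dmat Ψ) m p X Y) :
    IsPartialTrace (Dmat Ψ) (m + 1) (p + 1)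
      (chain (m + 1) (F.map (algebraMap K A)) p (m - p) * extR K m X *
        revChain (m + 1) (F⁻¹.map (algebraMap K A)) p (m - p)) (extR K p Y) := by
  induction h with
  | refl m X =>
    simp only [Nat.sub_self, chain, revChain, one_mul, mul_one]
    exact .refl _ _
  | step m p X Y h ih =>
    have hp := h.le
    refine .step (m + 1) (p + 1) _ _ ?_
    have e : m + 1 - p = (m - p) + 1 := by omega
    rw [e, chain, revChain, show p + (m - p) = m by omega,
      ← chain_extR (K := K) _ _ _ (by omega), ← revChain_extR (K := K) _ _ _ (by omega)]
    have := qtr1_conj hΨ hF hFu X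
    have assoc {B : Type _} [Ring B] (a b c d e : B) :
        a * b * c * (d * e) = a * (b * c * d * e) := by simp only [mul_assoc]
    rw [assoc, qtr1_extR_mul, qtr1_mul_extR, this, ← mul_assoc]
    exact ih

end IsPartialTrace

theorem extR_diagonal (m : ℕ) (z : A) :
    extR K m (Matrix.diagonal fun _ => z) = (Matrix.diagonal fun _ => z : Op N A (m + 1)) := by
  ext a b
  obtain ⟨a, x, rfl⟩ := snoc_surj a
  obtain ⟨b, y, rfl⟩ := snoc_surj b
  rw [extR_apply]
  by_cases h : a = b <;> by_cases h' : x = y <;> simp [h, h']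

theorem qtrAll_mul_diagonal (D : Matrix (Fin N) (Fin N) K) {m : ℕ} (X : Op N A m) (z : A) :
    qtrAll D (X * Matrix.diagonal fun _ => z) = qtrAll D X * z := by
  simp [qtrAll, Finset.sum_mul, mul_assoc]

end PartialTrace

section Families

variable {K : Type*} [Field K] {A : Type*} [Ring A] [Algebra K A] {N : ℕ}

theorem site_of_not_lt {m i : ℕ} (h : ¬ i + 1 < m) (X : M2 N A) : site m i X = 1 := by
  ext a b
  simp [site, h, Matrix.one_apply]

/-- The operator `site m i F` as a unit. -/
noncomputable def siteUnit (A : Type*) [Ring A] [Algebra K A] {F : M2 N K} (hF : IsUnit F) (m i : ℕ) :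
    (Op N A m)ˣ where
  val := site m i (F.map (algebraMap K A))
  inv := site m i (F⁻¹.map (algebraMap K A))
  val_inv := by
    by_cases h : i + 1 < m
    · rw [← opMap_site, ← opMap_site, ← map_mul, site_mul_inv hF h, map_one]
    · rw [site_of_not_lt h, site_of_not_lt h, one_mul]
  inv_val := by
    by_cases h : i + 1 < m
    · rw [← opMap_site, ← opMap_site, ← map_mul, site_inv_mul hF h, map_one]
    · rw [site_of_not_lt h, site_of_not_lt h, one_mul]

theorem chain_eq_run (m : ℕ) (X : M2 N A) (i : ℕ) :
    ∀ l, chain m X i l = run (fun j => site m j X) i l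
  | 0 => rfl
  | l + 1 => by rw [chain, run, chain_eq_run m X i l]

theorem MbarSeg_eq_run (m : ℕ) (F Finv : M2 N A) (M : Matrix (Fin N) (Fin N) A) (i : ℕ) :
    ∀ l, MbarSeg m F Finv M i l = run (Mbar m F Finv M) i l
  | 0 => rfl
  | l + 1 => by rw [MbarSeg, run, MbarSeg_eq_run m F Finv M i l]

theorem chain_mul_revChain {F : M2 N K} (hF : IsUnit F) (m p : ℕ) :
    ∀ l, chain m (F.map (algebraMap K A)) p l * revChain m (F⁻¹.map (algebraMap K A)) p l = 1
  | 0 => one_mul 1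
  | l + 1 => by
    have h := (siteUnit A hF m (p + l)).mul_inv
    have h' : site m (p + l) (F.map (algebraMap K A)) * site m (p + l) (F⁻¹.map (algebraMap K A))
      = 1 := h
    rw [chain, revChain, mul_assoc, ← mul_assoc (site m _ _), h', one_mul,
      chain_mul_revChain hF m p l]

theorem site_triple_map {m i : ℕ} (h : i + 2 < m) {X Y Z X' Y' Z' : M2 N K}
    (H : site 3 0 X * site 3 1 Y * site 3 0 Z = site 3 1 X' * site 3 0 Y' * site 3 1 Z') :
    (site m i (X.map (algebraMap K A)) * site m (i + 1) (Y.map (algebraMap K A)) *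
        site m i (Z.map (algebraMap K A)) : Op N A m) =
      site m (i + 1) (X'.map (algebraMap K A)) * site m i (Y'.map (algebraMap K A)) *
        site m (i + 1) (Z'.map (algebraMap K A)) := by
  simp only [← opMap_site, ← map_mul]
  rw [site_triple h H]

theorem IsGenerators.extend {R F : M2 N K} {M : Matrix (Fin N) (Fin N) A}
    (hM : IsGenerators R F M) {m : ℕ} (hm : 1 < m) :
    site m 0 (R.map (algebraMap K A)) *
        MbarSeg m (F.map (algebraMap K A)) (F⁻¹.map (algebraMap K A)) M 0 2 =
      MbarSeg m (F.map (algebraMap K A)) (F⁻¹.map (algebraMap K A)) M 0 2 *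
        site m 0 ((RFF R F).map (algebraMap K A)) := by
  induction m, hm using Nat.le_induction with
  | base => exact hM
  | succ m hm ih =>
    have := congrArg (extR K m) ih
    rwa [map_mul, map_mul, extR_site (by omega), extR_site (by omega),
      MbarSeg_extR _ _ _ _ _ (by omega)] at this

theorem isHeckeFamily_site {q : K} {R : M2 N K} (hH : IsHecke q R) (m : ℕ) :
    IsHeckeFamily q (fun i => (site m i (R.map (algebraMap K A)) : Op N A m)) m where
  braid i hi := site_triple_map hi hH.2.1
  quad i hi := by
    simp only [← opMap_site, ← map_mul]
    rw [site_quad hH.2.2 hi, map_add, map_one, map_smul]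
  comm i j hij hj := site_commute_site _ _ hij hj

theorem isTwistedFamily_site {R F : M2 N K} {M : Matrix (Fin N) (Fin N) A} (hF : IsUnit F)
    (h : Compatible R F) (hM : IsGenerators R F M) (m : ℕ) :
    IsTwistedFamily (siteUnit A hF m) (fun i => site m i (R.map (algebraMap K A)))
      (fun i => site m i ((RFF R F).map (algebraMap K A)))
      (Mbar m (F.map (algebraMap K A)) (F⁻¹.map (algebraMap K A)) M) m where
  braid i hi := site_triple_map hi h.2.1
  twist i hi := site_triple_map hi h.2.2.1
  twist' i hi := site_triple_map hi h.2.2.2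
  comm_ff i j hij hj := site_commute_site _ _ hij hj
  comm_fg i j hij hj := site_commute_site _ _ hij hj
  comm_gf i j hij hj := site_commute_site _ _ hij hj
  double_twist i hi := by
    change site m i ((RFF R F).map (algebraMap K A)) =
      site m i (F.map (algebraMap K A)) * (site m i (F.map (algebraMap K A)) *
        site m i (R.map (algebraMap K A)) * site m i (F⁻¹.map (algebraMap K A))) *
        site m i (F⁻¹.map (algebraMap K A))
    simp only [← opMap_site, ← map_mul]
    simp only [RFF, site_mul hi]
  conj_copy i hi := by
    change _ * _ = _ * _ * _ * _
    rw [mul_assoc _ (site m i _)]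
    exact ((congrArg _ (siteUnit A hF m i).inv_mul).trans (mul_one _)).symm
  comm_copy_f i j hij hj := Mbar_commute_site _ _ _ _ hij hj
  comm_copy_g i j hij hj := Mbar_commute_site _ _ _ _ hij hj
  rtt hm := by
    have := hM.extend hm
    simpa only [MbarSeg, one_mul, zero_add] using this

theorem qasym_eq_asym (q : K) (R : M2 N K) (m p : ℕ) :
    ∀ k, qasym q R m p k = asym q (fun i => site m i R) p k
  | 0 => rfl
  | 1 => rfl
  | k + 2 => by rw [qasym, asym, qasym_eq_asym q R m p (k + 1)]

theorem qasym_map (q : K) (R : M2 N K) (m p k : ℕ) :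
    (qasym q R m p k).map (algebraMap K A) =
      asym q (fun i => (site m i (R.map (algebraMap K A)) : Op N A m)) p k := by
  rw [← opMap_apply, qasym_eq_asym, map_asym]
  simp only [opMap_site]

end Families

section Newton

variable {K : Type*} [Field K] {A : Type*} [Ring A] [Algebra K A] {N : ℕ}

theorem extR_asym_site (q : K) (R : M2 N A) {m p k : ℕ} (h : p + k ≤ m) :
    extR K m (asym q (fun i => site m i R) p k) = asym q (fun i => site (m + 1) i R) p k := by
  induction k using Nat.strong_induction_on with
  | _ k ih =>
    match k with
    | 0 => exact map_one _
    | 1 => exact map_one _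
    | k + 2 =>
      simp only [asym, map_smul, map_mul, map_sub, map_one, ih (k + 1) (by omega) (by omega)]
      rw [extR_site (by omega)]

variable {R F Ψ : M2 N K} {M : Matrix (Fin N) (Fin N) A}

theorem isPartialTrace_asym_mul (q : K) (hΨ : IsClosedPair F Ψ) (hF : IsUnit F)
    (h : Compatible R F) (hM : IsGenerators R F M) (i : ℕ) : ∀ p : ℕ,
    IsPartialTrace (Dmat Ψ) (i + p) p
      (asym q (fun j => site (i + p) j (R.map (algebraMap K A))) p i *
        MbarSeg (i + p) (F.map (algebraMap K A)) (F⁻¹.map (algebraMap K A)) M p i)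
      (Matrix.diagonal fun _ => sigmaF q R F Ψ M i)
  | 0 => by
    have e : sigmaF q R F Ψ M i = qtrAll (Dmat Ψ)
        (asym q (fun j => site i j (R.map (algebraMap K A))) 0 i *
          MbarSeg i (F.map (algebraMap K A)) (F⁻¹.map (algebraMap K A)) M 0 i) := by
      rw [sigmaF, qasym_map]
    rw [e]
    exact IsPartialTrace.scalar _ _
  | p + 1 => by
    have H := (isPartialTrace_asym_mul q hΨ hF h hM i p).conj hΨ h.twistRel_self hF
    rw [map_mul, extR_asym_site _ _ (by omega), MbarSeg_extR _ _ _ _ _ (by omega),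
      extR_diagonal, Nat.add_sub_cancel, MbarSeg_eq_run] at H
    have T := isTwistedFamily_site hF h hM (i + p + 1)
    have hc := chain_eq_run (i + p + 1) (F.map (algebraMap K A)) p i
    have h1 := SemiconjBy.asym q (T.run_f_semiconj_g p i (by omega))
    have h2 := SemiconjBy.run (T.run_f_semiconj_copy p i (by omega))
    have h3 := (h1.mul_right h2).eq
    change (run (fun j => site (i + p + 1) j (F.map (algebraMap K A))) p i) * _ =
      _ * (run (fun j => site (i + p + 1) j (F.map (algebraMap K A))) p i) at h3
    rw [← hc] at h3
    rw [h3, mul_assoc, chain_mul_revChain hF, mul_one, ← MbarSeg_eq_run] at H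
    exact H

theorem sF_mul_sigmaF (q : K) (hΨ : IsClosedPair F Ψ) (hF : IsUnit F)
    (h : Compatible R F) (hM : IsGenerators R F M) (i p : ℕ) :
    sF R F Ψ M (p + 1) * sigmaF q R F Ψ M i =
      qtrAll (Dmat Ψ) (run (fun j => site (i + (p + 1)) j (R.map (algebraMap K A))) 0 p *
        asym q (fun j => site (i + (p + 1)) j (R.map (algebraMap K A))) (p + 1) i *
        run (Mbar (i + (p + 1)) (F.map (algebraMap K A)) (F⁻¹.map (algebraMap K A)) M)
          0 (i + (p + 1))) := by
  have H := (isPartialTrace_asym_mul q hΨ hF h hM i (p + 1)).mul_left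
    (fun n => chain n (R.map (algebraMap K A)) 0 p *
      MbarSeg n (F.map (algebraMap K A)) (F⁻¹.map (algebraMap K A)) M 0 (p + 1))
    (fun n hn => by
      rw [map_mul, chain_extR _ _ _ (by omega), MbarSeg_extR _ _ _ _ _ (by omega)])
  have T := isTwistedFamily_site hF h hM (i + (p + 1))
  have hcomm : Commute (run (Mbar (i + (p + 1)) (F.map (algebraMap K A))
      (F⁻¹.map (algebraMap K A)) M) 0 (p + 1))
      (asym q (fun j => site (i + (p + 1)) j (R.map (algebraMap K A))) (p + 1) i) :=
    Commute.asym_right _ fun j hj hj' => (run_comm fun l _ hl =>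
      (T.comm_copy_g l j (by omega) (by omega)).symm).symm
  have H' := H.qtrAll_eq
  rw [qtrAll_mul_diagonal, chain_eq_run, MbarSeg_eq_run, MbarSeg_eq_run, mul_assoc,
    ← mul_assoc (run (Mbar _ _ _ _) 0 (p + 1)), hcomm.eq, mul_assoc] at H'
  have hr (x : ℕ → Op N A (i + (p + 1))) :
      run x 0 (i + (p + 1)) = run x 0 (p + 1) * run x (p + 1) i := by
    have := run_add x 0 (p + 1) i
    rwa [zero_add, add_comm (p + 1) i] at this
  rw [sF, ← H', hr, mul_assoc]

/-- The functional `Y ↦ Tr_F(1,…,m)(Y M_{\overline{1}}⋯M_{\overline{m}})`. -/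
noncomputable def charMap (F Ψ : M2 N K) (M : Matrix (Fin N) (Fin N) A) (m : ℕ) :
    Op N A m →ₗ[K] A where
  toFun Y := qtrAll (Dmat Ψ)
    (Y * run (Mbar m (F.map (algebraMap K A)) (F⁻¹.map (algebraMap K A)) M) 0 m)
  map_add' X Y := by
    simp only [qtrAll, add_mul, Matrix.add_apply, mul_add, Finset.sum_add_distrib]
  map_smul' c X := by
    simp only [qtrAll, smul_mul_assoc, Matrix.smul_apply, mul_smul_comm, Finset.smul_sum,
      RingHom.id_apply]

theorem charMap_site_mul (hΨ : IsClosedPair F Ψ) (hF : IsUnit F)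
    (h : Compatible R F) (hM : IsGenerators R F M) {m i : ℕ} (hi : i + 1 < m) (Y : Op N A m) :
    charMap F Ψ M m (site m i (R.map (algebraMap K A)) * Y) =
      charMap F Ψ M m (Y * site m i (R.map (algebraMap K A))) := by
  change qtrAll _ _ = qtrAll _ _
  rw [mul_assoc, ← opMap_site, qtrAll_site_mul hΨ hF h hi, opMap_site, opMap_site, mul_assoc,
    mul_assoc, (isTwistedFamily_site hF h hM m).g_mul_run_copy i m hi le_rfl]

end Newton

section Abstract

variable {K : Type*} [Field K] {B : Type*} [Ring B] [Algebra K B] {C : Type*} [AddCommGroup C]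
  [Module K C]

theorem asym_cyclic {φ : B →ₗ[K] C} {g : ℕ → B} {m : ℕ}
    (hφ : ∀ i, i + 1 < m → ∀ y, φ (g i * y) = φ (y * g i)) (q : K) (p k : ℕ) (h : p + k ≤ m)
    (y : B) : φ (asym q g p k * y) = φ (y * asym q g p k) := by
  induction k using Nat.strong_induction_on generalizing y with
  | _ k ih =>
    match k with
    | 0 => simp [asym]
    | 1 => simp [asym]
    | k + 2 =>
      have hk := ih (k + 1) (by omega) (by omega)
      have hmid (z : B) : φ ((q ^ (k + 1) • (1 : B) - qInt q (k + 1) • g (p + k)) * z) =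
          φ (z * (q ^ (k + 1) • (1 : B) - qInt q (k + 1) • g (p + k))) := by
        simp only [sub_mul, mul_sub, smul_mul_assoc, mul_smul_comm, one_mul, mul_one, map_sub,
          map_smul, hφ _ (show p + k + 1 < m by omega)]
      simp only [asym, smul_mul_assoc, mul_smul_comm, map_smul, mul_assoc]
      rw [hk, mul_assoc, hmid, mul_assoc, mul_assoc, hk]
      simp only [mul_assoc]

/-- Moving one strand from the antisymmetrizer to the cycle. -/
theorem qInt_smul_cycle_asym {q : K} (hqn : ∀ n : ℕ, 1 ≤ n → qInt q n ≠ 0) (hq0 : q ≠ 0)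
    (hq1 : q ^ 2 ≠ 1) {g : ℕ → B} {m : ℕ} (hg : IsHeckeFamily q g m) {φ : B →ₗ[K] C}
    (hφ : ∀ i, i + 1 < m → ∀ y, φ (g i * y) = φ (y * g i)) (p i : ℕ) (h : i + (p + 1) ≤ m) :
    qInt q (i + 1) • φ (run g 0 p * asym q g p (i + 1)) =
      q ^ i • φ (run g 0 p * asym q g (p + 1) i) -
        qInt q i • φ (run g 0 (p + 1) * asym q g (p + 1) i) := by
  have hcomm : Commute (asym q g (p + 1) i) (run g 0 p) :=
    (Commute.asym_right i fun j hj hj' => (run_comm fun l _ hl =>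
      (hg.comm l j (by omega) (by omega)).symm).symm).symm
  have hidem := asym_mul_self hqn hq0 hq1 hg (p := p + 1) i (by omega)
  have hred (x : B) : φ (run g 0 p * (asym q g (p + 1) i * x * asym q g (p + 1) i)) =
      φ (run g 0 p * x * asym q g (p + 1) i) := by
    rw [← mul_assoc, ← mul_assoc, ← hcomm.eq, mul_assoc, mul_assoc,
      asym_cyclic hφ q (p + 1) i (by omega), mul_assoc, mul_assoc, hidem, mul_assoc]
  rw [← map_smul, ← mul_smul_comm, smul_asym_succ_left hqn hq0 hq1 hg i p (by omega), hred]
  simp only [mul_sub, sub_mul, map_sub, smul_mul_assoc, mul_smul_comm, map_smul, mul_one, run,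
    zero_add]

theorem newton_telescope {q : K} (hqn : ∀ n : ℕ, 1 ≤ n → qInt q n ≠ 0) (hq0 : q ≠ 0)
    (hq1 : q ^ 2 ≠ 1) {g : ℕ → B} {j : ℕ} (hg : IsHeckeFamily q g (j + 1)) {φ : B →ₗ[K] C}
    (hφ : ∀ i, i + 1 < j + 1 → ∀ y, φ (g i * y) = φ (y * g i)) (n : ℕ) (hn : n ≤ j) :
    ((-1 : K) ^ n * qInt q (n + 1)) • φ (run g 0 (j - n) * asym q g (j - n) (n + 1)) =
      ∑ i ∈ Finset.range (n + 1),
        (-q) ^ i • φ (run g 0 (j - i) * asym q g (j - i + 1) i) := by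
  induction n with
  | zero =>
    simp [qInt_one hq0 hq1, asym]
  | succ n ih =>
    rw [Finset.sum_range_succ, ← ih (by omega), mul_smul,
      qInt_smul_cycle_asym hqn hq0 hq1 hg hφ _ _ (by omega), show j - (n + 1) + 1 = j - n by omega]
    rw [smul_sub, smul_smul, smul_smul, neg_pow q]
    rw [pow_succ (-1 : K) n, mul_neg_one, neg_mul, neg_mul, neg_smul (_ * qInt q (n + 1))]
    rw [sub_neg_eq_add, add_comm]

end Abstract

/-- Newton relations, antisymmetric form.  For a Hecke
R-matrix `R̂`, a compatible closed R-matrix `F̂` and a matrix of generators `M`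
of `M(R̂,F̂)`:  for every `k = j+1 ≥ 1`,
`(−1)^{k−1} k_q σ_k(M) = ∑_{i=0}^{k−1} (−q)^i s_{k−i}(M) σ_i(M)` in `A`. -/
theorem Newton_antisymmetric {K : Type} [Field K] {A : Type} [Ring A] [Algebra K A]
    {N : ℕ} (q : K) (R F Ψ : M2 N K) (M : Matrix (Fin N) (Fin N) A)
    (hq0 : q ≠ 0) (hq1 : q ^ 2 ≠ 1) (hqn : ∀ n : ℕ, 1 ≤ n → qInt q n ≠ 0)
    (hH : IsHecke q R) (hF : IsUnit F) (hΨ : IsClosedPair F Ψ)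
    (h : Compatible R F) (hM : IsGenerators R F M) :
    ∀ j : ℕ,
      ((-1 : K) ^ j * qInt q (j + 1)) • sigmaF q R F Ψ M (j + 1) =
        ∑ i ∈ Finset.range (j + 1),
          ((-q) ^ i) • (sF R F Ψ M (j + 1 - i) * sigmaF q R F Ψ M i) := by
  intro j
  have H := newton_telescope hqn hq0 hq1 (isHeckeFamily_site (A := A) hH (j + 1))
    (fun i hi y => charMap_site_mul (Ψ := Ψ) (M := M) hΨ hF h hM hi y) j le_rfl
  rw [Nat.sub_self, run, one_mul] at H
  rw [sigmaF, qasym_map, MbarSeg_eq_run]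
  refine H.trans (Finset.sum_congr rfl fun i hi => ?_)
  have hij : i ≤ j := by simpa [Nat.lt_succ_iff] using hi
  obtain ⟨p, rfl⟩ := Nat.exists_eq_add_of_le hij
  rw [show i + p + 1 - i = p + 1 by omega, Nat.add_sub_cancel_left, sF_mul_sigmaF q hΨ hF h hM]
  rfl

end CHN
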